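/- arXiv:1503.07184 — 3 statements merged into one kernel-verified Lean document; each statement's English description precedes it below -/
import Mathlib

section
/- Let P be a pentad and let v1, v2, v3, v4 be four distinct varieties belonging to P. Then the multiset consisting of two cubes of each of the varieties v1, v2, v3, v4 (eight cubes in all) contains a corner solution. -/
open scoped Classical

/-- A colored cube: a bijection assigning to each face (`Fin 6`) a color (`Fin 6`). -/
abbrev CCube := Equiv.Perm (Fin 6)

/-- The opposite-face involution: face `i` is opposite face `i + 3`. -/
def tau (i : Fin 6) : Fin 6 := i + 3

/-- Quarter-turn rotation about the axis through the face pair `{2, 5}`. -/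
def r1 : Equiv.Perm (Fin 6) := ([0, 1, 3, 4] : List (Fin 6)).formPerm

/-- Quarter-turn rotation about the axis through the face pair `{0, 3}`. -/
def r2 : Equiv.Perm (Fin 6) := ([1, 2, 4, 5] : List (Fin 6)).formPerm

/-- The rotation group of the cube, acting on the set of faces. -/
def G : Subgroup (Equiv.Perm (Fin 6)) := Subgroup.closure {r1, r2}

/-- Two colored cubes have the same variety iff one is obtained from the other by
precomposition with a rotation. -/
def sameVariety (c d : CCube) : Prop := ∃ g ∈ G, d = c * g

def varietySetoid : Setoid CCube where
  r := sameVariety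
  iseqv := by
    refine ⟨fun c => ⟨1, G.one_mem, (mul_one c).symm⟩, ?_, ?_⟩
    · rintro c d ⟨g, hg, rfl⟩
      exact ⟨g⁻¹, G.inv_mem hg, by group⟩
    · rintro a b c ⟨g, hg, rfl⟩ ⟨h, hh, rfl⟩
      exact ⟨g * h, G.mul_mem hg hh, by group⟩

/-- A variety is a `G`-orbit of colored cubes. -/
def Variety := Quotient varietySetoid

/-- The variety of a colored cube. -/
def varietyOf (c : CCube) : Variety := Quotient.mk varietySetoid c

/-- The three opposite pairs of colors of a colored cube. -/
def oppPairs (c : CCube) : Finset (Finset (Fin 6)) :=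
  Finset.image (fun i => ({c i, c (tau i)} : Finset (Fin 6))) Finset.univ

/-- The twelve adjacent pairs of colors of a colored cube. -/
def adjPairs (c : CCube) : Finset (Finset (Fin 6)) :=
  Finset.image (fun p : Fin 6 × Fin 6 => ({c p.1, c p.2} : Finset (Fin 6)))
    (Finset.univ.filter (fun p : Fin 6 × Fin 6 => p.2 ≠ p.1 ∧ p.2 ≠ tau p.1))

/-- The mirror cube of `c`. -/
def mirror (c : CCube) : CCube := c * Equiv.swap 0 3

/-- Cyclic rotation of an ordered triple. -/
def cyc (t : Fin 6 × Fin 6 × Fin 6) : Fin 6 × Fin 6 × Fin 6 := (t.2.1, t.2.2, t.1)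

/-- The cyclic equivalence class of an ordered triple. -/
def cycClass (t : Fin 6 × Fin 6 × Fin 6) : Finset (Fin 6 × Fin 6 × Fin 6) :=
  {t, cyc t, cyc (cyc t)}

/-- The eight corner triples of a colored cube: faces `0, 1, 2` meet at a corner, read
clockwise, and the corners of the cube are the images of this corner under rotations. -/
noncomputable def cornerTriples (c : CCube) : Finset (Finset (Fin 6 × Fin 6 × Fin 6)) :=
  Finset.univ.filter (fun s => ∃ g ∈ G, s = cycClass (c (g 0), c (g 1), c (g 2)))

/-- The opposite pairs of a variety. -/
noncomputable def vOpp (v : Variety) : Finset (Finset (Fin 6)) := oppPairs (Quotient.out v)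

/-- The adjacent pairs of a variety. -/
noncomputable def vAdj (v : Variety) : Finset (Finset (Fin 6)) := adjPairs (Quotient.out v)

/-- The corner triples of a variety. -/
noncomputable def vCorners (v : Variety) : Finset (Finset (Fin 6 × Fin 6 × Fin 6)) :=
  cornerTriples (Quotient.out v)

/-- The mirror variety of a variety. -/
noncomputable def vMirror (v : Variety) : Variety := varietyOf (mirror (Quotient.out v))

/-- A pentad: five varieties which pairwise share no corner triples and whose fifteen
opposite pairs comprise each unordered pair of colors exactly once. -/
def IsPentad (P : Finset Variety) : Prop :=
  P.card = 5 ∧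
  (∀ v ∈ P, ∀ w ∈ P, v ≠ w → vCorners v ∩ vCorners w = ∅) ∧
  (∀ p : Finset (Fin 6), p.card = 2 → ∃! v, v ∈ P ∧ p ∈ vOpp v)

/-- A corner solution from the multiset `S` modeled on the cube `m`: eight distinct cube
instances from `S` in bijection with the eight corner triples of `m`, each chosen cube having
its assigned corner triple among its own corner triples. -/
def CornerSolutionOn (S : Multiset CCube) (m : CCube) : Prop :=
  ∃ ψ : Finset (Fin 6 × Fin 6 × Fin 6) → CCube,
    Multiset.map ψ (cornerTriples m).val ≤ S ∧
    ∀ t ∈ cornerTriples m, t ∈ cornerTriples (ψ t)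

/-- `S` contains a corner solution modeled on some variety. -/
def HasCornerSolution (S : Multiset CCube) : Prop := ∃ m : CCube, CornerSolutionOn S m

/-- An `n`-frame solution from `S` modeled on the cube `m`: a corner solution together with,
for each of the twelve adjacent pairs of `m`, a further `n - 2` cube instances having that
adjacent pair, all `12n - 16` cube instances distinct. -/
def FrameSolutionOn (n : ℕ) (S : Multiset CCube) (m : CCube) : Prop :=
  ∃ (ψ : Finset (Fin 6 × Fin 6 × Fin 6) → CCube) (f : Finset (Fin 6) → Multiset CCube),
    (∀ t ∈ cornerTriples m, t ∈ cornerTriples (ψ t)) ∧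
    (∀ p ∈ adjPairs m, Multiset.card (f p) = n - 2 ∧ ∀ x ∈ f p, p ∈ adjPairs x) ∧
    Multiset.map ψ (cornerTriples m).val + (adjPairs m).sum f ≤ S

/-- `S` contains an `n`-frame solution modeled on some variety. -/
def HasFrameSolution (n : ℕ) (S : Multiset CCube) : Prop := ∃ m : CCube, FrameSolutionOn n S m

/-- The faces `0, 1, 2, …` around each of the eight corners of the cube, read clockwise. -/
def cornerFaces : Fin 8 → Fin 6 × Fin 6 × Fin 6 :=
  ![(0, 1, 2), (0, 2, 4), (0, 4, 5), (0, 5, 1), (3, 2, 1), (3, 4, 2), (3, 5, 4), (3, 1, 5)]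

/-- Apply a coloring of the faces to each entry of a triple. -/
def mapTriple (f : Fin 6 → Fin 6) (t : Fin 6 × Fin 6 × Fin 6) : Fin 6 × Fin 6 × Fin 6 :=
  (f t.1, f t.2.1, f t.2.2)

/-- A colored cube representing a variety. -/
noncomputable def Variety.rep (v : Variety) : CCube := Quotient.out v

/-- A computable form of `cornerTriples`, for arbitrary colorings of the faces. -/
def cornerSet (f : Fin 6 → Fin 6) : Finset (Finset (Fin 6 × Fin 6 × Fin 6)) :=
  Finset.univ.image fun k => cycClass (mapTriple f (cornerFaces k))

/-- A rotation written in terms of Euler angles. -/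
def eulerRotation (a b c : Fin 4) : Equiv.Perm (Fin 6) :=
  r1 ^ (a : ℕ) * r2 ^ (b : ℕ) * r1 ^ (c : ℕ)

/-- Colorings whose varieties, together with that of the identity, form the two pentads
containing the variety of the identity. -/
def tetrad (b : Bool) : Fin 4 → Fin 6 → Fin 6 :=
  if b then ![![0, 3, 1, 4, 5, 2], ![0, 3, 2, 5, 1, 4], ![0, 3, 4, 1, 2, 5], ![0, 3, 5, 2, 4, 1]]
  else ![![0, 3, 1, 5, 4, 2], ![0, 3, 2, 1, 5, 4], ![0, 3, 4, 2, 1, 5], ![0, 3, 5, 4, 2, 1]]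

lemma eulerRotation_mem (a b c : Fin 4) : eulerRotation a b c ∈ G :=
  have h1 : r1 ∈ G := Subgroup.subset_closure (by simp)
  have h2 : r2 ∈ G := Subgroup.subset_closure (by simp)
  G.mul_mem (G.mul_mem (G.pow_mem h1 _) (G.pow_mem h2 _)) (G.pow_mem h1 _)

lemma cycClass_mapTriple (f : Fin 6 → Fin 6) (t : Fin 6 × Fin 6 × Fin 6) :
    cycClass (mapTriple f t) = (cycClass t).image (mapTriple f) := by
  simp [cycClass, cyc, mapTriple, Finset.image_insert]

lemma cornerSet_comp (f g : Fin 6 → Fin 6) :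
    cornerSet (f ∘ g) = (cornerSet g).image (Finset.image (mapTriple f)) := by
  simp only [cornerSet, Finset.image_image]
  exact Finset.image_congr fun k _ => cycClass_mapTriple f (mapTriple g (cornerFaces k))

lemma image_mapTriple_injective (σ : CCube) :
    Function.Injective (Finset.image (mapTriple σ)) := by
  refine Finset.image_injective ?_
  rintro ⟨a, b, c⟩ ⟨x, y, z⟩ h
  simpa [mapTriple] using h

lemma card_cornerSet_comp_inter (σ : CCube) (f g : Fin 6 → Fin 6) :
    (cornerSet (σ ∘ f) ∩ cornerSet (σ ∘ g)).card = (cornerSet f ∩ cornerSet g).card := by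
  rw [cornerSet_comp, cornerSet_comp, ← Finset.image_inter _ _ (image_mapTriple_injective σ),
    Finset.card_image_of_injective _ (image_mapTriple_injective σ)]

lemma card_cornerSet_id : (cornerSet id).card = 8 := by decide

lemma card_cornerSet (c : CCube) : (cornerSet c).card = 8 := by
  simpa [card_cornerSet_id] using card_cornerSet_comp_inter c id id

lemma cornerSet_rotation {g : CCube} (hg : g ∈ G) : cornerSet g = cornerSet id := by
  induction hg using Subgroup.closure_induction with
  | mem x hx =>
    rcases hx with rfl | rfl
    · decide
    · decide
  | one => rfl
  | mul x y _ _ hx hy => rw [Equiv.Perm.coe_mul, cornerSet_comp, hy, ← cornerSet_comp]; exact hx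
  | inv x _ hx =>
    have h := cornerSet_comp (x⁻¹ : CCube) x
    rw [hx, ← cornerSet_comp, ← Equiv.Perm.coe_mul, inv_mul_cancel] at h
    exact h.symm

lemma cornerSet_mul_rotation (c : CCube) {g : CCube} (hg : g ∈ G) :
    cornerSet (c * g : CCube) = cornerSet c := by
  rw [Equiv.Perm.coe_mul, cornerSet_comp, cornerSet_rotation hg, ← cornerSet_comp,
    Function.comp_id]

lemma exists_eulerRotation_corner : ∀ k : Fin 8, ∃ a b c : Fin 4,
    mapTriple (eulerRotation a b c) (0, 1, 2) = cornerFaces k := by decide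

lemma exists_eulerRotation_edge : ∀ i j : Fin 6, j ≠ i → j ≠ tau i → ∃ a b c : Fin 4,
    eulerRotation a b c 0 = i ∧ eulerRotation a b c 1 = j := by decide

lemma cornerTriples_eq (c : CCube) : cornerTriples c = cornerSet c := by
  ext s
  simp only [cornerTriples, Finset.mem_filter, Finset.mem_univ, true_and]
  constructor
  · rintro ⟨g, hg, rfl⟩
    rw [← cornerSet_mul_rotation c hg, cornerSet, Finset.mem_image]
    exact ⟨0, Finset.mem_univ _, by simp [mapTriple, cornerFaces]⟩
  · intro hs
    obtain ⟨k, -, rfl⟩ := Finset.mem_image.mp hs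
    obtain ⟨x, y, z, h⟩ := exists_eulerRotation_corner k
    exact ⟨_, eulerRotation_mem x y z, by rw [← h]; rfl⟩

lemma vCorners_eq (v : Variety) : vCorners v = cornerSet v.rep :=
  cornerTriples_eq _

lemma cornerTriples_out {c : CCube} {v : Variety} (h : varietyOf c = v) :
    cornerTriples c = vCorners v := by
  obtain ⟨g, hg, hd⟩ : sameVariety c (Quotient.out v) :=
    Quotient.exact (h.trans (Quotient.out_eq v).symm)
  rw [vCorners, hd, cornerTriples_eq, cornerTriples_eq, cornerSet_mul_rotation c hg]

lemma vector_mem_tetrad : ∀ x y z w : Fin 6, [0, 3, x, y, z, w].Nodup →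
    cornerSet ![0, 3, x, y, z, w] ∩ cornerSet id = ∅ →
    ∃ b i, tetrad b i = ![0, 3, x, y, z, w] := by decide

lemma exists_eq_tetrad (p : CCube) (h0 : p 0 = 0) (h1 : p 1 = 3)
    (h : cornerSet p ∩ cornerSet id = ∅) : ∃ b i, tetrad b i = p := by
  have hp : ⇑p = ![0, 3, p 2, p 3, p 4, p 5] := by
    funext i; fin_cases i <;> simp [h0, h1]
  rw [hp] at h ⊢
  refine vector_mem_tetrad _ _ _ _ ?_ h
  have := (List.nodup_finRange 6).map p.injective
  simpa [List.finRange, h0, h1] using this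

lemma card_inter_tetrad : ∀ b i j,
    (cornerSet (tetrad b i) ∩ cornerSet (tetrad (!b) j)).card = 2 := by decide

lemma bijective_tetrad : ∀ b i, Function.Bijective (tetrad b i) := by decide

/-- A variety sharing neither corner triples nor opposite pairs with that of `c` is
represented, relative to `c`, by a member of one of the two tetrads. -/
lemma exists_cornerSet_eq_tetrad (c d : CCube) (hc : cornerSet d ∩ cornerSet c = ∅)
    (ho : ({c 0, c 3} : Finset (Fin 6)) ∉ oppPairs d) :
    ∃ b i, cornerSet d = cornerSet (c ∘ tetrad b i) := by
  obtain ⟨x, y, z, h0, h1⟩ := exists_eulerRotation_edge (d⁻¹ (c 0)) (d⁻¹ (c 3)) (by simp) (by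
    intro h
    refine ho (Finset.mem_image.mpr ⟨d⁻¹ (c 0), Finset.mem_univ _, ?_⟩)
    rw [← h]; simp)
  have hg := eulerRotation_mem x y z
  have hd : cornerSet d = cornerSet (c ∘ (c⁻¹ * d * eulerRotation x y z : CCube)) := by
    rw [← Equiv.Perm.coe_mul, ← mul_assoc, ← mul_assoc, mul_inv_cancel, one_mul,
      cornerSet_mul_rotation d hg]
  obtain ⟨b, i, h⟩ := exists_eq_tetrad (c⁻¹ * d * eulerRotation x y z) (by simp [h0])
    (by simp [h1]) (by
      rw [← Finset.card_eq_zero, ← card_cornerSet_comp_inter c, ← hd, Function.comp_id, hc,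
        Finset.card_empty])
  exact ⟨b, i, by rw [hd, h]⟩

/-- If four cubes with pairwise disjoint sets of corner triples each share two corner triples
with `m`, then two copies of each of them contain a corner solution modeled on `m`. -/
lemma cornerSolutionOn_of_card_inter (m : CCube) (c : Fin 4 → CCube)
    (hd : Pairwise fun i j => Disjoint (cornerTriples (c i)) (cornerTriples (c j)))
    (hm : ∀ i, (cornerTriples m ∩ cornerTriples (c i)).card = 2) :
    CornerSolutionOn (∑ i, Multiset.replicate 2 (c i)) m := by
  have hdisj : Set.PairwiseDisjoint (Finset.univ : Finset (Fin 4))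
      fun i => cornerTriples m ∩ cornerTriples (c i) := fun i _ j _ hij =>
    (hd hij).mono Finset.inter_subset_right Finset.inter_subset_right
  have hU : Finset.univ.biUnion (fun i => cornerTriples m ∩ cornerTriples (c i)) =
      cornerTriples m := by
    refine Finset.eq_of_subset_of_card_le
      (Finset.biUnion_subset.mpr fun i _ => Finset.inter_subset_left) ?_
    rw [Finset.card_biUnion hdisj, Finset.sum_congr rfl fun i _ => hm i, cornerTriples_eq,
      card_cornerSet]
    simp
  have hex : ∀ t ∈ cornerTriples m, ∃ i, t ∈ cornerTriples (c i) := fun t ht => by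
    rw [← hU] at ht
    obtain ⟨i, -, hi⟩ := Finset.mem_biUnion.mp ht
    exact ⟨i, (Finset.mem_inter.mp hi).2⟩
  choose! φ hφ using hex
  refine ⟨fun t => c (φ t), le_of_eq ?_, hφ⟩
  have key : ∀ i, ∀ t ∈ cornerTriples m ∩ cornerTriples (c i), φ t = i := fun i t ht => by
    by_contra hne
    rw [Finset.mem_inter] at ht
    exact Finset.disjoint_left.mp (hd hne) (hφ t ht.1) ht.2
  calc
    _ = ∑ t ∈ cornerTriples m, {c (φ t)} := by
      rw [← Multiset.sum_map_singleton (Multiset.map _ _), Multiset.map_map]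
      rfl
    _ = ∑ i, ∑ t ∈ cornerTriples m ∩ cornerTriples (c i), {c (φ t)} := by
      rw [← Finset.sum_biUnion hdisj, hU]
    _ = ∑ i, Multiset.replicate 2 (c i) := by
      refine Finset.sum_congr rfl fun i _ => ?_
      rw [Finset.sum_congr rfl fun t ht => by rw [key i t ht], Finset.sum_const, hm,
        Multiset.nsmul_singleton]

/-- The family version of `four_of_pentad`. -/
lemma hasCornerSolution_of_pentad {P : Finset Variety} (hP : IsPentad P) (v : Fin 4 → Variety)
    (hv : ∀ i, v i ∈ P) (hinj : Function.Injective v) (c : Fin 4 → CCube)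
    (hc : ∀ i, varietyOf (c i) = v i) :
    HasCornerSolution (∑ i, Multiset.replicate 2 (c i)) := by
  obtain ⟨hcard, hcor, hopp⟩ := hP
  obtain ⟨w, hw, hwv⟩ : ∃ w ∈ P, w ∉ Finset.univ.image v :=
    Finset.exists_mem_notMem_of_card_lt_card (by
      rw [Finset.card_image_of_injective _ hinj, hcard]; simp)
  have hvw : ∀ i, v i ≠ w := fun i h => hwv (Finset.mem_image.mpr ⟨i, Finset.mem_univ _, h⟩)
  have hout : ∀ i, cornerTriples (c i) = cornerSet (v i).rep := fun i => by
    rw [cornerTriples_out (hc i), vCorners_eq]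
  have hrel : ∀ i, ∃ b j, cornerTriples (c i) = cornerSet (w.rep ∘ tetrad b j) := by
    intro i
    rw [hout]
    refine exists_cornerSet_eq_tetrad _ _ ?_ fun hmem => ?_
    · rw [← vCorners_eq, ← vCorners_eq]
      exact hcor _ (hv i) _ hw (hvw i)
    · have hpair : ({w.rep 0, w.rep 3} : Finset (Fin 6)).card = 2 :=
        Finset.card_pair (by simp)
      have hself : ({w.rep 0, w.rep 3} : Finset (Fin 6)) ∈ vOpp w :=
        Finset.mem_image.mpr ⟨0, Finset.mem_univ _, rfl⟩
      exact hvw i ((hopp _ hpair).unique ⟨hv i, hmem⟩ ⟨hw, hself⟩)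
  choose b j hbj using hrel
  have hd : Pairwise fun i k => Disjoint (cornerTriples (c i)) (cornerTriples (c k)) :=
    fun i k hik => by
      beta_reduce
      rw [cornerTriples_out (hc i), cornerTriples_out (hc k), Finset.disjoint_iff_inter_eq_empty]
      exact hcor _ (hv i) _ (hv k) (hinj.ne hik)
  have hb : ∀ i, b i = b 0 := fun i => by
    by_contra hne
    have h := Finset.disjoint_iff_inter_eq_empty.mp (hd fun h : (0 : Fin 4) = i => hne (h ▸ rfl))
    rw [hbj, hbj, ← Finset.card_eq_zero, card_cornerSet_comp_inter, Bool.eq_not_of_ne hne,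
      card_inter_tetrad] at h
    exact two_ne_zero h
  refine ⟨w.rep * Equiv.ofBijective _ (bijective_tetrad (!b 0) 0),
    cornerSolutionOn_of_card_inter _ c hd fun i => ?_⟩
  rw [cornerTriples_eq, Equiv.Perm.coe_mul, Equiv.coe_ofBijective, hbj, hb i,
    card_cornerSet_comp_inter, Finset.inter_comm, card_inter_tetrad]

/-- Two cubes of each of four distinct varieties belonging to a pentad always contain a
corner solution. -/
theorem four_of_pentad (P : Finset Variety) (hP : IsPentad P)
    (v1 v2 v3 v4 : Variety) (h1 : v1 ∈ P) (h2 : v2 ∈ P) (h3 : v3 ∈ P) (h4 : v4 ∈ P)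
    (h12 : v1 ≠ v2) (h13 : v1 ≠ v3) (h14 : v1 ≠ v4)
    (h23 : v2 ≠ v3) (h24 : v2 ≠ v4) (h34 : v3 ≠ v4)
    (c1 c2 c3 c4 : CCube)
    (hc1 : varietyOf c1 = v1) (hc2 : varietyOf c2 = v2)
    (hc3 : varietyOf c3 = v3) (hc4 : varietyOf c4 = v4) :
    HasCornerSolution (Multiset.replicate 2 c1 + Multiset.replicate 2 c2 +
      Multiset.replicate 2 c3 + Multiset.replicate 2 c4) := by
  have h := hasCornerSolution_of_pentad hP ![v1, v2, v3, v4]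
    (by simp [Fin.forall_fin_succ, h1, h2, h3, h4])
    (by
      intro i j
      fin_cases i <;> fin_cases j <;>
        simp [h12, h13, h14, h23, h24, h34, h12.symm, h13.symm, h14.symm, h23.symm, h24.symm,
          h34.symm])
    ![c1, c2, c3, c4] (by simp [Fin.forall_fin_succ, hc1, hc2, hc3, hc4])
  simpa [Fin.sum_univ_four] using h
end

section
/- Let S be a multiset of colored cubes whose distinct varieties are v1, …, vn with respective multiplicities a1 ≥ a2 ≥ … ≥ an ≥ 1 and with a2 ≥ 4. If either (a1 = 7 and a2 + n ≥ 13) or (a1 = 6 and a2 + n ≥ 14), then S contains a corner solution. -/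
open scoped Classical

/-- The ordered triple of faces `x, y, z` meets at a corner and is read clockwise. -/
def IsClockwise (x y z : Fin 6) : Prop :=
  (y.val % 3 = (x.val + 1) % 3 ∧ z.val % 3 = (x.val + 2) % 3 ∧ (x.val + y.val + z.val) % 2 = 1) ∨
  (y.val % 3 = (x.val + 2) % 3 ∧ z.val % 3 = (x.val + 1) % 3 ∧ (x.val + y.val + z.val) % 2 = 0)

instance (x y z : Fin 6) : Decidable (IsClockwise x y z) := by
  unfold IsClockwise; infer_instance

/-- One clockwise reading of each of the eight corners. -/
def corner : Fin 8 → Fin 6 × Fin 6 × Fin 6 :=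
  ![(0, 1, 2), (0, 2, 4), (0, 4, 5), (0, 5, 1), (3, 2, 1), (3, 1, 5), (3, 4, 2), (3, 5, 4)]

/-- The corners carried by the face map `p` to clockwise corners. -/
def keptCorners (p : Fin 6 → Fin 6) : Finset (Fin 8) :=
  Finset.univ.filter fun k => IsClockwise (p (corner k).1) (p (corner k).2.1) (p (corner k).2.2)

/-- Face lists of one cube in each of the nine varieties without a corner of the identity cube. -/
def disjointFaces : Fin 9 → Fin 6 → Fin 6 :=
  ![![0, 1, 3, 2, 5, 4], ![0, 1, 3, 4, 5, 2], ![0, 1, 4, 5, 2, 3], ![0, 1, 4, 5, 3, 2],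
    ![0, 1, 5, 2, 3, 4], ![0, 1, 5, 3, 4, 2], ![0, 1, 5, 4, 2, 3], ![0, 2, 5, 1, 3, 4],
    ![0, 2, 5, 1, 4, 3]]

/-- The inverses of the permutations listed in `disjointFaces`. -/
def disjointFacesInv : Fin 9 → Fin 6 → Fin 6 :=
  ![![0, 1, 3, 2, 5, 4], ![0, 1, 5, 2, 3, 4], ![0, 1, 4, 5, 2, 3], ![0, 1, 5, 4, 2, 3],
    ![0, 1, 3, 4, 5, 2], ![0, 1, 5, 3, 4, 2], ![0, 1, 4, 5, 3, 2], ![0, 3, 1, 4, 5, 2],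
    ![0, 3, 1, 5, 4, 2]]

/-- One cube in each of the nine varieties without a corner of the identity cube. -/
def disjointCube (i : Fin 9) : CCube where
  toFun := disjointFaces i
  invFun := disjointFacesInv i
  left_inv := by revert i; decide
  right_inv := by revert i; decide

lemma isClockwise_map_iff {g : CCube} (hg : g ∈ G) :
    ∀ x y z, IsClockwise (g x) (g y) (g z) ↔ IsClockwise x y z := by
  induction hg using Subgroup.closure_induction with
  | mem g hg =>
    rcases hg with rfl | rfl <;> decide +kernel
  | one => simp
  | mul g h _ _ hg hh => intro x y z; simp [hg, hh]
  | inv g _ hg => intro x y z; rw [← hg]; simp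

lemma exists_rotation_word : ∀ x y z, IsClockwise x y z → ∃ i j k : Fin 4,
    ∀ l : Fin 6, (r1 ^ i.val * r2 ^ j.val * r1 ^ k.val) l = ![x, y, z, x + 3, y + 3, z + 3] l := by
  decide +kernel

lemma rotation_word_mem_G (i j k : ℕ) : r1 ^ i * r2 ^ j * r1 ^ k ∈ G :=
  have h1 : r1 ∈ G := Subgroup.subset_closure (by simp)
  have h2 : r2 ∈ G := Subgroup.subset_closure (by simp)
  G.mul_mem (G.mul_mem (G.pow_mem h1 i) (G.pow_mem h2 j)) (G.pow_mem h1 k)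

lemma mem_G_of_isClockwise {p : CCube} (hp : ∀ i, p (i + 3) = p i + 3)
    (h : IsClockwise (p 0) (p 1) (p 2)) : p ∈ G := by
  obtain ⟨i, j, k, hw⟩ := exists_rotation_word _ _ _ h
  suffices p = r1 ^ i.val * r2 ^ j.val * r1 ^ k.val from this ▸ rotation_word_mem_G i j k
  ext l
  rw [hw l]
  congr 1
  fin_cases l
  · rfl
  · rfl
  · rfl
  · exact hp 0
  · exact hp 1
  · exact hp 2

lemma keptCorners_rotation_mul {g : CCube} (hg : g ∈ G) (p : CCube) :
    keptCorners (g * p : CCube) = keptCorners p := by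
  ext k
  simp [keptCorners, isClockwise_map_iff hg]

lemma exists_rotation_apply_eq_zero (i : Fin 6) : ∃ g ∈ G, g i = 0 := by
  have h : ∀ i, ∃ j k : Fin 4, (r1 ^ j.val * r2 ^ k.val * r1 ^ 0) i = 0 := by decide +kernel
  obtain ⟨j, k, h⟩ := h i
  exact ⟨_, rotation_word_mem_G j k 0, h⟩

lemma forall_perm_fixing_zero {P : (Fin 6 → Fin 6) → Prop}
    (h : ∀ b, b ≠ 0 → ∀ c, c ≠ 0 ∧ c ≠ b → ∀ d, d ≠ 0 ∧ d ≠ b ∧ d ≠ c →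
      ∀ e, e ≠ 0 ∧ e ≠ b ∧ e ≠ c ∧ e ≠ d → ∀ f, f ≠ 0 ∧ f ≠ b ∧ f ≠ c ∧ f ≠ d ∧ f ≠ e →
      P ![0, b, c, d, e, f]) {p : CCube} (h0 : p 0 = 0) : P p := by
  have hp : ⇑p = ![0, p 1, p 2, p 3, p 4, p 5] := by
    ext i; fin_cases i <;> simp [h0]
  rw [hp]
  have hz : ∀ i, p i = 0 ↔ i = 0 := fun i =>
    ⟨fun h => p.injective (h.trans h0.symm), fun h => h ▸ h0⟩
  apply h <;> simp [hz]

lemma keptCorners_eq_empty_or_two_le_card (p : CCube) :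
    keptCorners p = ∅ ∨ 2 ≤ (keptCorners p).card := by
  obtain ⟨g, hg, h0⟩ := exists_rotation_apply_eq_zero (p 0)
  rw [← keptCorners_rotation_mul hg]
  exact forall_perm_fixing_zero (P := fun p => keptCorners p = ∅ ∨ 2 ≤ (keptCorners p).card)
    (by decide +kernel) h0

lemma exists_mul_disjointCube_mem_G {p : CCube} (hp : keptCorners p = ∅) :
    ∃ i, p * disjointCube i ∈ G := by
  obtain ⟨g, hg, h0⟩ := exists_rotation_apply_eq_zero (p 0)
  rw [← keptCorners_rotation_mul hg] at hp
  obtain ⟨i, hi, hi'⟩ := forall_perm_fixing_zero (P := fun p => keptCorners p = ∅ →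
    ∃ i, (∀ k, p (disjointCube i (k + 3)) = p (disjointCube i k) + 3) ∧
      IsClockwise (p (disjointCube i 0)) (p (disjointCube i 1)) (p (disjointCube i 2)))
    (by decide +kernel) (p := g * p) h0 hp
  have := mem_G_of_isClockwise (p := g * p * disjointCube i) hi hi'
  rw [mul_assoc] at this
  exact ⟨i, (G.mul_mem_cancel_left hg).1 this⟩

/-- The corners of `disjointCube i` that `disjointCube j` has as well. -/
def sharedCorners (i j : Fin 9) : Finset (Fin 8) :=
  keptCorners ((disjointCube j)⁻¹ * disjointCube i : CCube)

lemma card_sharedCorners_eq_empty_le (i : Fin 9) :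
    (Finset.univ.filter fun j => j ≠ i ∧ sharedCorners i j = ∅).card ≤ 3 := by
  revert i; decide +kernel

lemma card_mem_sharedCorners_le (i : Fin 9) (k : Fin 8) :
    (Finset.univ.filter fun j => j ≠ i ∧ k ∈ sharedCorners i j).card ≤ 2 := by
  revert i k; decide +kernel

lemma exists_mem_G_of_isClockwise {x y z : Fin 6} (h : IsClockwise x y z) :
    ∃ g ∈ G, g 0 = x ∧ g 1 = y ∧ g 2 = z := by
  obtain ⟨i, j, k, hw⟩ := exists_rotation_word _ _ _ h
  exact ⟨_, rotation_word_mem_G i j k, hw 0, hw 1, hw 2⟩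

lemma cycClass_cyc (t : Fin 6 × Fin 6 × Fin 6) : cycClass (cyc t) = cycClass t := by
  ext s
  simp only [cycClass, cyc, Finset.mem_insert, Finset.mem_singleton]
  tauto

/-- The corner triple of the cube `m` at its `k`-th corner. -/
def cornerTriple (m : CCube) (k : Fin 8) : Finset (Fin 6 × Fin 6 × Fin 6) :=
  cycClass (m (corner k).1, m (corner k).2.1, m (corner k).2.2)

lemma exists_cornerTriple_eq {m : CCube} {t : Finset (Fin 6 × Fin 6 × Fin 6)}
    (ht : t ∈ cornerTriples m) : ∃ k, cornerTriple m k = t := by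
  simp only [cornerTriples, Finset.mem_filter, Finset.mem_univ, true_and] at ht
  obtain ⟨g, hg, rfl⟩ := ht
  have hcover : ∀ x y z, IsClockwise x y z → ∃ k, (x, y, z) ∈ cycClass (corner k) := by
    decide +kernel
  obtain ⟨k, hk⟩ := hcover _ _ _ ((isClockwise_map_iff hg 0 1 2).2 (by decide))
  refine ⟨k, ?_⟩
  simp only [cycClass, cyc, Finset.mem_insert, Finset.mem_singleton, Prod.ext_iff] at hk
  rcases hk with ⟨h0, h1, h2⟩ | ⟨h0, h1, h2⟩ | ⟨h0, h1, h2⟩ <;>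
    rw [h0, h1, h2]
  · rfl
  · exact (cycClass_cyc _).symm
  · exact ((cycClass_cyc _).trans (cycClass_cyc _)).symm

lemma cornerTriple_mem_cornerTriples {m w : CCube} {k : Fin 8}
    (hk : k ∈ keptCorners (w⁻¹ * m : CCube)) : cornerTriple m k ∈ cornerTriples w := by
  simp only [keptCorners, Finset.mem_filter, Finset.mem_univ, true_and] at hk
  obtain ⟨g, hg, h0, h1, h2⟩ := exists_mem_G_of_isClockwise hk
  simp only [cornerTriples, Finset.mem_filter, Finset.mem_univ, true_and]
  refine ⟨g, hg, ?_⟩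
  rw [h0, h1, h2]
  simp [cornerTriple]

lemma cornerTriple_self_mem (m : CCube) (k : Fin 8) : cornerTriple m k ∈ cornerTriples m := by
  apply cornerTriple_mem_cornerTriples
  rw [inv_mul_cancel]
  revert k
  decide +kernel

lemma cornerTriples_subset_of_sameVariety {c d : CCube} (h : sameVariety c d) :
    cornerTriples d ⊆ cornerTriples c := by
  obtain ⟨g, hg, rfl⟩ := h
  intro t
  simp only [cornerTriples, Finset.mem_filter, Finset.mem_univ, true_and]
  rintro ⟨h, hh, rfl⟩
  exact ⟨g * h, G.mul_mem hg hh, rfl⟩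

lemma Finset.exists_map_val_eq {α β : Type*} [Nonempty β] (s : Finset α) (T : Multiset β)
    (h : s.card = T.card) : ∃ ψ : α → β, s.val.map ψ = T := by
  induction s using Finset.induction_on generalizing T with
  | empty =>
    refine ⟨fun _ => Classical.arbitrary β, ?_⟩
    simpa [eq_comm] using h
  | insert a s ha ih =>
    rw [Finset.card_insert_of_notMem ha] at h
    obtain ⟨b, hb⟩ := Multiset.card_pos_iff_exists_mem.1 (show 0 < T.card by omega)
    obtain ⟨T, rfl⟩ := Multiset.exists_cons_of_mem hb
    obtain ⟨ψ, hψ⟩ := ih T (by simpa using h)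
    refine ⟨Function.update ψ a b, ?_⟩
    rw [Finset.insert_val_of_notMem ha, Multiset.map_cons, Function.update_self, ← hψ]
    congr 1
    refine Multiset.map_congr rfl fun x hx => Function.update_of_ne ?_ _ _
    rintro rfl
    exact ha hx

/-- Instances of the cubes `v i` can be chosen in `S` for each element of `C`, as prescribed
by `f`, if no `v i` is used more often than its multiplicity. -/
lemma exists_map_le_of_card_fiber_le {ι α : Type*} [DecidableEq ι] {v : ι → CCube}
    (hdist : ∀ i j, i ≠ j → ¬ sameVariety (v i) (v j)) (S : Multiset CCube) (C : Finset α)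
    (f : α → ι)
    (hf : ∀ i, (C.filter fun t => f t = i).card ≤
      (S.filter fun x => sameVariety x (v i)).card) :
    ∃ ψ : α → CCube, C.val.map ψ ≤ S ∧ ∀ t ∈ C, sameVariety (ψ t) (v (f t)) := by
  have hψ : ∀ i, ∃ ψ : α → CCube, (C.filter fun t => f t = i).val.map ψ ≤
      S.filter fun x => sameVariety x (v i) := by
    intro i
    obtain ⟨T, hT⟩ := Multiset.card_pos_iff_exists_mem.1
      (Multiset.card_powersetCard _ (S.filter fun x => sameVariety x (v i)) ▸
        Nat.choose_pos (hf i))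
    obtain ⟨hT, hcard⟩ := Multiset.mem_powersetCard.1 hT
    obtain ⟨ψ, hψ⟩ := Finset.exists_map_val_eq _ T hcard.symm
    exact ⟨ψ, hψ ▸ hT⟩
  choose ψ hψ using hψ
  have hmem : ∀ t ∈ C, sameVariety (ψ (f t) t) (v (f t)) := by
    intro t ht
    refine (Multiset.mem_filter.1 (Multiset.mem_of_le (hψ (f t)) ?_)).2
    exact Multiset.mem_map_of_mem _ (Finset.mem_filter.2 ⟨ht, rfl⟩)
  refine ⟨fun t => ψ (f t) t, Multiset.le_iff_count.2 fun x => ?_, hmem⟩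
  rcases Finset.eq_empty_or_nonempty (C.filter fun t => x = ψ (f t) t) with he | ⟨s, hs⟩
  · rw [Multiset.count_map, ← Finset.filter_val, he]
    simp
  · obtain ⟨hs, hxs⟩ := Finset.mem_filter.1 hs
    refine le_trans ?_ ((Multiset.count_le_of_le x (hψ (f s))).trans
      (Multiset.count_le_of_le x (Multiset.filter_le _ _)))
    rw [Multiset.count_map, Multiset.count_map, ← Finset.filter_val, ← Finset.filter_val]
    refine Finset.card_le_card fun t ht => ?_
    obtain ⟨ht, hxt⟩ := Finset.mem_filter.1 ht
    have hts : f t = f s := by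
      by_contra hne
      refine hdist _ _ hne (varietySetoid.trans (varietySetoid.symm (hmem t ht)) ?_)
      rw [← hxt, hxs]
      exact hmem s hs
    simp only [Finset.mem_filter]
    exact ⟨⟨ht, hts⟩, hts ▸ hxt⟩

lemma hasCornerSolution_of_assignment {n : ℕ} {v : Fin n → CCube}
    (hdist : ∀ i j, i ≠ j → ¬ sameVariety (v i) (v j)) {S : Multiset CCube} (m : CCube)
    (f : Fin 8 → Fin n) (hshare : ∀ k, cornerTriple m k ∈ cornerTriples (v (f k)))
    (hf : ∀ i, (Finset.univ.filter fun k => f k = i).card ≤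
      (S.filter fun x => sameVariety x (v i)).card) :
    HasCornerSolution S := by
  choose! c hc using fun t => exists_cornerTriple_eq (m := m) (t := t)
  obtain ⟨ψ, hle, hψ⟩ := exists_map_le_of_card_fiber_le hdist S (cornerTriples m) (f ∘ c)
    fun i => (hf i).trans' <| Finset.card_le_card_of_injOn c
      (fun t ht => by simpa using (Finset.mem_filter.1 ht).2)
      fun s hs t ht hst => by
        rw [← hc s (Finset.mem_filter.1 hs).1, hst, hc t (Finset.mem_filter.1 ht).1]
  refine ⟨m, ψ, hle, fun t ht => cornerTriples_subset_of_sameVariety (hψ t ht) ?_⟩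
  have := hshare (c t)
  rwa [hc t ht] at this

/-- A model `m` of the variety of `v i₀` is solved by instances of `v i₀` together with one cube
of each variety indexed by `J`, placed at distinct corners. -/
lemma hasCornerSolution_of_injOn {n : ℕ} {v : Fin n → CCube}
    (hdist : ∀ i j, i ≠ j → ¬ sameVariety (v i) (v j)) {S : Multiset CCube}
    (hpos : ∀ i, 1 ≤ (S.filter fun x => sameVariety x (v i)).card)
    {i₀ : Fin n} {m : CCube} (hm : sameVariety (v i₀) m) {J : Finset (Fin n)} (hJ : i₀ ∉ J)
    {h : Fin n → Fin 8} (hinj : Set.InjOn h J)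
    (hshare : ∀ j ∈ J, cornerTriple m (h j) ∈ cornerTriples (v j))
    (hcard : 8 ≤ (S.filter fun x => sameVariety x (v i₀)).card + J.card) :
    HasCornerSolution S := by
  have hown : ∀ k, cornerTriple m k ∈ cornerTriples (v i₀) := fun k =>
    cornerTriples_subset_of_sameVariety hm (cornerTriple_self_mem m k)
  have hf : ∀ k, ∃ i, (i ∈ J ∧ h i = k) ∨ (i = i₀ ∧ k ∈ (J.image h)ᶜ) := by
    intro k
    by_cases hk : k ∈ J.image h
    · obtain ⟨j, hj⟩ := Finset.mem_image.1 hk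
      exact ⟨j, .inl hj⟩
    · exact ⟨i₀, .inr ⟨rfl, Finset.mem_compl.2 hk⟩⟩
  choose f hf using hf
  refine hasCornerSolution_of_assignment hdist m f (fun k => ?_) fun i => ?_
  · rcases hf k with ⟨hj, hk⟩ | ⟨hi, -⟩
    · simpa only [hk] using hshare _ hj
    · exact hi ▸ hown k
  · rcases eq_or_ne i i₀ with rfl | hi
    · have hsub : (Finset.univ.filter fun k => f k = i) ⊆ (J.image h)ᶜ := by
        intro k hk
        have hk : f k = i := (Finset.mem_filter.1 hk).2
        rcases hf k with ⟨hj, -⟩ | ⟨-, hk'⟩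
        · exact absurd (hk ▸ hj) hJ
        · exact hk'
      refine (Finset.card_le_card hsub).trans ?_
      rw [Finset.card_compl, Finset.card_image_of_injOn hinj, Fintype.card_fin]
      omega
    · refine (Finset.card_le_one.2 fun k hk l hl => ?_).trans (hpos i)
      have hval : ∀ k, f k = i → h i = k := fun k hk => by
        rcases hf k with ⟨-, hk'⟩ | ⟨hk', -⟩
        · rwa [hk] at hk'
        · exact absurd (hk.symm.trans hk') hi
      rw [← hval k (Finset.mem_filter.1 hk).2, ← hval l (Finset.mem_filter.1 hl).2]

/-- Varieties that have no corner of the identity cube, but some corner of `disjointCube i`,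
satisfy Hall's condition for the corners of `disjointCube i`. -/
lemma exists_injOn_sharedCorners {i : Fin 9} {A : Finset (Fin 9)} (hi : i ∉ A)
    (hA : ∀ j ∈ A, sharedCorners i j ≠ ∅) :
    ∃ h : Fin 9 → Fin 8, Set.InjOn h A ∧ ∀ j ∈ A, h j ∈ sharedCorners i j := by
  have hall : ∀ B : Finset A, B.card ≤ (B.biUnion fun j => sharedCorners i j).card := by
    intro B
    refine Nat.le_of_mul_le_mul_right (Finset.card_mul_le_card_mul (m := 2) (n := 2)
      (fun (j : A) k => k ∈ sharedCorners i j) (fun j hj => ?_) fun k _ => ?_) two_pos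
    · refine ((keptCorners_eq_empty_or_two_le_card _).resolve_left (hA j j.2)).trans
        (Finset.card_le_card fun k hk => ?_)
      exact Finset.mem_filter.2 ⟨Finset.mem_biUnion.2 ⟨j, hj, hk⟩, hk⟩
    · refine (Finset.card_le_card_of_injOn Subtype.val (fun j hj => ?_)
        Subtype.val_injective.injOn).trans (card_mem_sharedCorners_le i k)
      have hk := (Finset.mem_filter.1 hj).2
      simpa [hk] using fun h : (j : Fin 9) = i => hi (h ▸ j.2)
  obtain ⟨h, hinj, hmem⟩ := (Finset.all_card_le_biUnion_card_iff_exists_injective _).1 hall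
  refine ⟨fun j => if hj : j ∈ A then h ⟨j, hj⟩ else 0, fun j hj k hk hjk => ?_, fun j hj => ?_⟩
  · have hj : j ∈ A := hj
    have hk : k ∈ A := hk
    simp only [hj, hk, dite_true] at hjk
    exact congrArg Subtype.val (hinj hjk)
  · simpa only [hj, dite_true] using hmem ⟨j, hj⟩

/-- Many varieties that share no corner with `c` admit a corner solution modeled on one of
them. -/
lemma hasCornerSolution_of_keptCorners_eq_empty {n : ℕ} {v : Fin n → CCube}
    (hdist : ∀ i j, i ≠ j → ¬ sameVariety (v i) (v j)) {S : Multiset CCube}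
    (hpos : ∀ i, 1 ≤ (S.filter fun x => sameVariety x (v i)).card) {c : CCube}
    {i₀ : Fin n} {J : Finset (Fin n)} (hJ : i₀ ∉ J)
    (hempty : ∀ j ∈ insert i₀ J, keptCorners ((v j)⁻¹ * c : CCube) = ∅)
    (hcard : 11 ≤ (S.filter fun x => sameVariety x (v i₀)).card + J.card) :
    HasCornerSolution S := by
  have hd : ∀ j ∈ insert i₀ J, ∃ i, sameVariety (v j) (c * disjointCube i) := fun j hj => by
    obtain ⟨i, hi⟩ := exists_mul_disjointCube_mem_G (hempty j hj)
    exact ⟨i, _, hi, by group⟩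
  choose! d hd using hd
  have hinj : Set.InjOn d (insert i₀ J : Finset (Fin n)) := fun i hi j hj hij => by
    by_contra hne
    exact hdist i j hne (varietySetoid.trans (hd i hi) (varietySetoid.symm (hij ▸ hd j hj)))
  have hi₀ := Finset.mem_insert_self i₀ J
  have hne : ∀ j ∈ J, d j ≠ d i₀ := fun j hj h => hJ <|
    hinj (Finset.mem_insert_of_mem hj) hi₀ h ▸ hj
  have hinjJ : Set.InjOn d J := hinj.mono (by simp)
  obtain ⟨h, hh, hmem⟩ := exists_injOn_sharedCorners (i := d i₀)
    (A := (J.filter fun j => sharedCorners (d i₀) (d j) ≠ ∅).image d)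
    (by simpa using fun j hj _ => hne j hj) (by
      intro l hl
      obtain ⟨j, hj, rfl⟩ := Finset.mem_image.1 hl
      exact (Finset.mem_filter.1 hj).2)
  have hfew : (J.filter fun j => sharedCorners (d i₀) (d j) = ∅).card ≤ 3 :=
    (Finset.card_le_card_of_injOn d (fun j hj => by
      have hj := Finset.mem_filter.1 hj
      simpa [hj.2] using hne j hj.1)
      (hinjJ.mono (Finset.filter_subset _ _))).trans (card_sharedCorners_eq_empty_le (d i₀))
  have hsplit := Finset.card_filter_add_card_filter_not (s := J)
    (fun j => sharedCorners (d i₀) (d j) = ∅)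
  refine hasCornerSolution_of_injOn hdist hpos (hd i₀ hi₀)
    (J := J.filter fun j => sharedCorners (d i₀) (d j) ≠ ∅) (h := h ∘ d)
    (fun h => hJ (Finset.mem_filter.1 h).1) (fun i hi j hj hij => ?_) (fun j hj => ?_)
    (by simp only [ne_eq]; omega)
  · exact hinjJ (Finset.mem_filter.1 hi).1 (Finset.mem_filter.1 hj).1
      (hh (Finset.mem_image_of_mem d hi) (Finset.mem_image_of_mem d hj) hij)
  · refine cornerTriples_subset_of_sameVariety
      (hd j (Finset.mem_insert_of_mem (Finset.mem_filter.1 hj).1))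
      (cornerTriple_mem_cornerTriples ?_)
    have := hmem (d j) (Finset.mem_image_of_mem d hj)
    rwa [sharedCorners, show (disjointCube (d j))⁻¹ * disjointCube (d i₀) =
      (c * disjointCube (d j))⁻¹ * (c * disjointCube (d i₀)) by group] at this

/-- A cube that shares two corners with `v i₀` solves these two, with `v i₀` at the other six. -/
lemma hasCornerSolution_of_repeated {n : ℕ} {v : Fin n → CCube}
    (hdist : ∀ i j, i ≠ j → ¬ sameVariety (v i) (v j)) {S : Multiset CCube} {i₀ i₁ : Fin n}
    (hne : i₁ ≠ i₀) {k l : Fin 8} (hkl : k ≠ l)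
    (hk : cornerTriple (v i₀) k ∈ cornerTriples (v i₁))
    (hl : cornerTriple (v i₀) l ∈ cornerTriples (v i₁))
    (h₀ : 6 ≤ (S.filter fun x => sameVariety x (v i₀)).card)
    (h₁ : 2 ≤ (S.filter fun x => sameVariety x (v i₁)).card) :
    HasCornerSolution S := by
  refine hasCornerSolution_of_assignment hdist (v i₀)
    (fun x => if x ∈ ({k, l} : Finset (Fin 8)) then i₁ else i₀) (fun x => ?_) fun i => ?_
  · by_cases hx : x ∈ ({k, l} : Finset (Fin 8))
    · rw [if_pos hx]
      rcases Finset.mem_insert.1 hx with h | h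
      · exact h ▸ hk
      · exact Finset.mem_singleton.1 h ▸ hl
    · rw [if_neg hx]
      exact cornerTriple_self_mem _ _
  · have hcard := Finset.card_pair hkl
    rcases eq_or_ne i i₁ with rfl | hi₁
    · refine (Finset.card_le_card fun x hx => ?_).trans (hcard.trans_le h₁)
      by_contra hx'
      simp only [Finset.mem_filter, hx', if_false] at hx
      exact hne hx.2.symm
    · rcases eq_or_ne i i₀ with rfl | hi₀
      · refine (Finset.card_le_card (t := {k, l}ᶜ) fun x hx => ?_).trans ?_
        · rw [Finset.mem_compl]
          intro hx'
          simp only [Finset.mem_filter, hx', if_true] at hx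
          exact hne hx.2
        · rw [Finset.card_compl, hcard]
          exact h₀
      · rw [Finset.card_eq_zero.2]
        · exact Nat.zero_le _
        · refine Finset.filter_eq_empty_iff.2 fun x _ h => ?_
          split_ifs at h
          exacts [hi₁ h.symm, hi₀ h.symm]

/-- If a multiset of colored cubes has distinct varieties `v 0, …, v (n-1)` with decreasing
multiplicities `a 0 ≥ a 1 ≥ … ≥ a (n-1) ≥ 1`, `a 1 ≥ 4`, and either (`a 0 = 7` and
`a 1 + n ≥ 13`) or (`a 0 = 6` and `a 1 + n ≥ 14`), then it contains a corner solution. -/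
theorem partition_corner_solution (n : ℕ) (hn : 2 ≤ n) (v : Fin n → CCube) (a : Fin n → ℕ)
    (hdist : ∀ i j : Fin n, i ≠ j → ¬ sameVariety (v i) (v j))
    (hmono : ∀ i j : Fin n, i ≤ j → a j ≤ a i)
    (hpos : ∀ i : Fin n, 1 ≤ a i)
    (ha2 : 4 ≤ a ⟨1, hn⟩)
    (S : Multiset CCube)
    (hcover : ∀ x ∈ S, ∃ i : Fin n, sameVariety x (v i))
    (hcount : ∀ i : Fin n, Multiset.card (S.filter (fun x => sameVariety x (v i))) = a i)
    (hcond : (a ⟨0, by omega⟩ = 7 ∧ 13 ≤ a ⟨1, hn⟩ + n) ∨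
             (a ⟨0, by omega⟩ = 6 ∧ 14 ≤ a ⟨1, hn⟩ + n)) :
    HasCornerSolution S := by
  have hpos' : ∀ i, 1 ≤ (S.filter fun x => sameVariety x (v i)).card :=
    fun i => (hpos i).trans_eq (hcount i).symm
  set i₀ : Fin n := ⟨0, by omega⟩ with hi₀
  set i₁ : Fin n := ⟨1, hn⟩ with hi₁
  have hne : i₁ ≠ i₀ := by simp [hi₀, hi₁]
  let K : Fin n → Finset (Fin 8) := fun j => keptCorners ((v j)⁻¹ * v i₀ : CCube)
  let J : Finset (Fin n) := Finset.univ.filter fun j => j ≠ i₀ ∧ K j ≠ ∅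
  have hK : ∀ j ∈ J, 1 < (K j).card := fun j hj =>
    (keptCorners_eq_empty_or_two_le_card _).resolve_left (Finset.mem_filter.1 hj).2.2
  have hi₀J : i₀ ∉ J := fun h => (Finset.mem_filter.1 h).2.1 rfl
  have hshare : ∀ j, ∀ k ∈ K j, cornerTriple (v i₀) k ∈ cornerTriples (v j) :=
    fun j k hk => cornerTriple_mem_cornerTriples hk
  by_cases hi₁J : i₁ ∈ J
  · obtain ⟨k, hk, l, hl, hkl⟩ := Finset.one_lt_card.1 (hK i₁ hi₁J)
    refine hasCornerSolution_of_repeated hdist hne hkl (hshare i₁ k hk) (hshare i₁ l hl) ?_ ?_ <;>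
      rw [hcount] <;> omega
  · by_cases hJ : 8 ≤ a i₀ + J.card
    · rcases hcond with ⟨ha, -⟩ | ⟨ha, -⟩
      · obtain ⟨j, hj⟩ := Finset.card_pos.1 (show 0 < J.card by omega)
        obtain ⟨k, hk, -⟩ := Finset.one_lt_card.1 (hK j hj)
        refine hasCornerSolution_of_injOn hdist hpos' (varietySetoid.refl (v i₀)) (J := {j})
          (h := fun _ => k) ?_ (by simp) (by simpa using hshare j k hk) ?_
        · simpa using fun h : i₀ = j => hi₀J (h ▸ hj)
        · rw [hcount, ha, Finset.card_singleton]
      · obtain ⟨i, hi, j, hj, hij⟩ := Finset.one_lt_card.1 (show 1 < J.card by omega)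
        obtain ⟨k, hk, -⟩ := Finset.one_lt_card.1 (hK i hi)
        obtain ⟨l, hl, hlk⟩ := Finset.exists_mem_ne (hK j hj) k
        refine hasCornerSolution_of_injOn hdist hpos' (varietySetoid.refl (v i₀)) (J := {i, j})
          (h := fun x => if x = i then k else l) ?_ ?_ ?_ ?_
        · simpa using ⟨fun h : i₀ = i => hi₀J (h ▸ hi), fun h : i₀ = j => hi₀J (h ▸ hj)⟩
        · simp [Set.InjOn, hij, hij.symm, hlk, hlk.symm]
        · simpa [hij.symm] using ⟨hshare i k hk, hshare j l hl⟩
        · rw [hcount, ha, Finset.card_pair hij]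
    · refine hasCornerSolution_of_keptCorners_eq_empty hdist hpos' (c := v i₀) (i₀ := i₁)
        (J := (insert i₀ (insert i₁ J))ᶜ) (by simp) (fun j hj => ?_) ?_
      · by_contra hne'
        have hj₀ : j ≠ i₀ := by
          rintro rfl
          simp [hne.symm] at hj
        have hjJ : j ∈ J := Finset.mem_filter.2 ⟨Finset.mem_univ _, hj₀, hne'⟩
        have hj₁ : j ≠ i₁ := fun h => hi₁J (h ▸ hjJ)
        simp [hj₁, hjJ] at hj
      · have h₁ := Finset.card_insert_le i₁ J
        have h₂ := Finset.card_insert_le i₀ (insert i₁ J)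
        rw [hcount, Finset.card_compl, Fintype.card_fin]
        omega
end

section
/- Every multiset of 24 colored cubes contains a corner solution: there is a subset of eight of the cubes that forms a corner solution modeled on some variety. -/
open scoped Classical

/-! ### Packed states

A function `ℕ → ℕ` on the 36 indices `6 * a + b` is packed into one natural number, one byte per
index. The functions below are written with the operations `Nat.add`, `Nat.land`, ... that the
kernel evaluates on numerals, and `forceNat` makes it evaluate intermediate results. -/

/-- Evaluates `n` to a numeral before passing it on. -/
def forceNat {α : Type} (n : ℕ) (f : ℕ → α) : α :=
  Nat.rec (f 0) (fun k _ => f (Nat.succ k)) n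

/-- Byte `e` of `X`. -/
def byte (X e : ℕ) : ℕ := Nat.mod (Nat.div X (Nat.pow 256 e)) 256

/-- The sum of `f k` over `k < n`. -/
def sumTo (f : ℕ → ℕ) (n : ℕ) : ℕ := Nat.rec 0 (fun k s => Nat.add s (f k)) n

/-- The number with byte `k` equal to `f k` modulo 256 for `k < 36`. -/
def pack (f : ℕ → ℕ) : ℕ := sumTo (fun k => Nat.mul (Nat.mod (f k) 256) (Nat.pow 256 k)) 36

/-- The transposition of `a` and `b`. -/
def swapNat (a b x : ℕ) : ℕ := bif Nat.beq x a then b else bif Nat.beq x b then a else x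

/-- The action of the transposition of `a` and `b` on the index `6 * x + y` of the arc `(x, y)`. -/
def swapArc (a b e : ℕ) : ℕ :=
  Nat.add (Nat.mul 6 (swapNat a b (Nat.div e 6))) (swapNat a b (Nat.mod e 6))

/-- The packed indicator of the arc `(a, b)`. -/
def arcMask (a b : ℕ) : ℕ := Nat.mul 255 (Nat.pow 256 (Nat.add (Nat.mul 6 a) b))

/-- The packed indicator of the arcs of the directed triangle `a → b → c → a`. -/
def triangleMask (a b c : ℕ) : ℕ :=
  Nat.add (arcMask a b) (Nat.add (arcMask b c) (arcMask c a))

/-- The two pairs of disjoint directed triangles containing `a → b → x`. -/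
def trianglePairs (a b x y z u : ℕ) : List ℕ :=
  [Nat.add (triangleMask a b x) (triangleMask y z u),
    Nat.add (triangleMask a b x) (triangleMask y u z)]

/-- The eight pairs of disjoint directed triangles on six points through the arc `w`. -/
def cycleMasks (w : ℕ) : List ℕ :=
  let a := w / 6
  let b := w % 6
  match (List.range 6).filter (fun i => !(Nat.beq i a || Nat.beq i b)) with
  | [p, q, r, s] => trianglePairs a b p q r s ++ (trianglePairs a b q p r s ++
      (trianglePairs a b r p q s ++ trianglePairs a b s p q r))
  | _ => []

/-! ### The refutation checker

A state `(L, U)` stands for all functions `n` with `L ≤ n ≤ U` bytewise. -/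

/-- Whether a set of at most `c` masks whose union contains `m` can violate Hall's condition, where
`K` is the sum of the bytes of `U`. -/
def feasible (K L U m c : ℕ) : Bool :=
  bif Nat.ble c (Nat.mod (Nat.land L m) 255) then false
  else Nat.ble (Nat.add 25 (Nat.mod (Nat.land U m) 255)) (Nat.add c K)

/-- Runs through the sets of masks that can violate Hall's condition. The accumulator `A` is the
intersection of their unions and `g` bounds the gap between their size and their lower bound. -/
def visit (K L U : ℕ) : List ℕ → ℕ → ℕ → ℕ → ℕ → (ℕ → ℕ → Bool) → Bool
  | [], m, c, A, g, k =>
    bif feasible K L U m c then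
      forceNat (Nat.land A m) fun A' =>
      forceNat (Nat.sub c (Nat.mod (Nat.land L m) 255)) fun d =>
      forceNat (bif Nat.ble g d then d else g) fun g' => k A' g'
    else k A g
  | p :: ps, m, c, A, g, k =>
    bif feasible K L U m c then
      forceNat (Nat.sub c 1) fun c' =>
      visit K L U ps m c' A g fun A' g' =>
      forceNat (Nat.lor m p) fun m' => visit K L U ps m' c A' g' k
    else k A g

/-- Whether no function of total 24 lies between `L` and `U`, by the obvious criteria. -/
def isDead (L U : ℕ) : Bool :=
  bif Nat.ble 24 (sumTo (byte U) 36) then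
    bif Nat.beq 0 (sumTo (fun e => Nat.sub (byte L e) (byte U e)) 36) then false else true
  else true

/-- Lowers `U` to at most `L + g - 1` at the indices in `A`. -/
def lowerUpper (L U A g : ℕ) : ℕ :=
  pack fun e => forceNat (byte U e) fun u => bif Nat.beq (byte A e) 0 then u else
    forceNat (Nat.sub (Nat.add (byte L e) g) 1) fun v => bif Nat.ble u v then u else v

/-- Whether the transposition of `a` and `b` preserves `X`. -/
def isSymm (a b X : ℕ) : Bool :=
  Nat.beq 0 (sumTo (fun e => bif Nat.beq (byte X (swapArc a b e)) (byte X e) then 0 else 1) 36)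

/-- Enlarges the set `O` by its image under the transposition of `a` and `b`, if the latter
preserves the state. -/
def orbitStep (a b L U O : ℕ) : ℕ :=
  bif isSymm a b L then bif isSymm a b U then
    pack fun e => Nat.lor (byte O e) (byte O (swapArc a b e))
  else O else O

/-- Enlarges the set `O` by `n` steps, running through the transpositions in `mask`. -/
def orbit (mask L U O n : ℕ) : ℕ :=
  Nat.rec O (fun k O' =>
    bif Nat.beq (Nat.mod (Nat.div mask (Nat.pow 2 (Nat.mod k 36))) 2) 0 then O' else
      forceNat (Nat.div (Nat.mod k 36) 6) fun a => forceNat (Nat.mod k 6) fun b =>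
      forceNat O' fun O' => orbitStep a b L U O') n

/-- Pushes a state unless it is dead. -/
def pushState (L U : ℕ) (stk : List (ℕ × ℕ)) : List (ℕ × ℕ) :=
  bif isDead L U then stk else (L, U) :: stk

/-- Follows a list of instructions for refuting a stack of states. An instruction below 36
lowers the upper bounds by Hall's condition at that arc; any other instruction splits the top
state at an arc, up to symmetry. -/
def refute : List ℕ → List (ℕ × ℕ) → Bool
  | _, [] => true
  | [], _ :: _ => false
  | d :: ds, s :: stk =>
    bif Nat.ble 36 d then
      forceNat (Nat.mod d 36) fun e => forceNat (Nat.mod (Nat.div d 36) 8) fun mid =>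
      forceNat (orbit (Nat.div d 288) s.1 s.2 (Nat.pow 256 e) 72) fun O =>
      forceNat (pack fun v => bif Nat.beq v e then mid else byte s.1 v) fun L =>
      forceNat (pack fun v => bif Nat.beq (byte O v) 0 then byte s.2 v else Nat.sub mid 1)
        fun U => refute ds (pushState L s.2 (pushState s.1 U stk))
    else bif Nat.beq (Nat.mod d 7) 0 then false else
      forceNat (sumTo (byte s.2) 36) fun K => forceNat (List.length (cycleMasks d)) fun c =>
      visit K s.1 s.2 (cycleMasks d) 0 c (Nat.sub (Nat.pow 256 36) 1) 0 fun A g =>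
        bif Nat.beq g 0 then refute ds stk else
        forceNat (lowerUpper s.1 s.2 A g) fun U => refute ds (pushState s.1 U stk)

/-- The upper bound `M` on all arcs between distinct points. -/
def startUpper (M : ℕ) : ℕ := pack fun e => bif Nat.beq (Nat.mod e 7) 0 then 0 else M

/-- The state with lower bound `M` at the arc `(0, 1)` and upper bound `N` on all arcs. -/
def startState (M N : ℕ) : ℕ × ℕ := (Nat.mul M 256, startUpper N)

/-! ### Bytes -/

theorem forceNat_eq {α : Type} (n : ℕ) (f : ℕ → α) : forceNat n f = f n := by
  cases n <;> rfl

theorem cond_beq {α : Type} (a b : ℕ) (x y : α) :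
    (bif Nat.beq a b then x else y) = if a = b then x else y := by
  simp only [Bool.cond_eq_ite, Nat.beq_eq]

theorem cond_ble {α : Type} (a b : ℕ) (x y : α) :
    (bif Nat.ble a b then x else y) = if a ≤ b then x else y := by
  simp only [Bool.cond_eq_ite, Nat.ble_eq]

theorem byte_eq (X e : ℕ) : byte X e = X / 256 ^ e % 256 := rfl

theorem byte_lt (X e : ℕ) : byte X e < 256 := Nat.mod_lt _ (by norm_num)

theorem sumTo_eq (f : ℕ → ℕ) (n : ℕ) : sumTo f n = ∑ k ∈ Finset.range n, f k := by
  induction n with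
  | zero => rfl
  | succ n ih => rw [Finset.sum_range_succ, ← ih]; rfl

theorem sumTo_bytes_lt (f : ℕ → ℕ) (n : ℕ) :
    sumTo (fun k => Nat.mul (Nat.mod (f k) 256) (Nat.pow 256 k)) n < 256 ^ n := by
  induction n with
  | zero => simp [sumTo]
  | succ n ih =>
    rw [sumTo_eq] at ih ⊢
    rw [Finset.sum_range_succ, pow_succ]
    have h : f n % 256 ≤ 255 := by omega
    have h' : f n % 256 * 256 ^ n ≤ 255 * 256 ^ n := Nat.mul_le_mul_right _ h
    change _ + f n % 256 * 256 ^ n < _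
    omega

theorem byte_sumTo_bytes (f : ℕ → ℕ) {n e : ℕ} (h : e < n) :
    byte (sumTo (fun k => Nat.mul (Nat.mod (f k) 256) (Nat.pow 256 k)) n) e = f e % 256 := by
  induction n with
  | zero => omega
  | succ n ih =>
    have hlt := sumTo_bytes_lt f n
    have hs : sumTo (fun k => Nat.mul (Nat.mod (f k) 256) (Nat.pow 256 k)) (n + 1) =
      sumTo (fun k => Nat.mul (Nat.mod (f k) 256) (Nat.pow 256 k)) n + f n % 256 * 256 ^ n := rfl
    rw [hs, byte_eq]
    rcases Nat.lt_succ_iff_lt_or_eq.1 h with h | rfl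
    · obtain ⟨d, rfl⟩ := Nat.exists_eq_add_of_lt h
      rw [← ih h, byte_eq, show f (e + d + 1) % 256 * 256 ^ (e + d + 1) =
        256 ^ e * (256 * (f (e + d + 1) % 256 * 256 ^ d)) by ring,
        Nat.add_mul_div_left _ _ (by positivity), Nat.add_mul_mod_self_left]
    · rw [Nat.add_mul_div_right _ _ (by positivity), Nat.div_eq_of_lt hlt]
      omega

theorem byte_pack (f : ℕ → ℕ) {e : ℕ} (h : e < 36) : byte (pack f) e = f e % 256 :=
  byte_sumTo_bytes f h

theorem byte_pack_of_lt (f : ℕ → ℕ) {e : ℕ} (h : e < 36) (hf : f e < 256) :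
    byte (pack f) e = f e := by
  rw [byte_pack f h, Nat.mod_eq_of_lt hf]

theorem pack_lt (f : ℕ → ℕ) : pack f < 256 ^ 36 := sumTo_bytes_lt f 36

theorem byte_land (X Y e : ℕ) : byte (Nat.land X Y) e = Nat.land (byte X e) (byte Y e) := by
  change (X &&& Y) / 256 ^ e % 256 = (X / 256 ^ e % 256) &&& (Y / 256 ^ e % 256)
  rw [show 256 ^ e = 2 ^ (8 * e) by rw [pow_mul]; norm_num, show 256 = 2 ^ 8 by norm_num,
    Nat.and_div_two_pow, Nat.and_mod_two_pow]

theorem byte_lor (X Y e : ℕ) : byte (Nat.lor X Y) e = Nat.lor (byte X e) (byte Y e) := by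
  change (X ||| Y) / 256 ^ e % 256 = (X / 256 ^ e % 256) ||| (Y / 256 ^ e % 256)
  rw [show 256 ^ e = 2 ^ (8 * e) by rw [pow_mul]; norm_num, show 256 = 2 ^ 8 by norm_num,
    Nat.or_div_two_pow, Nat.or_mod_two_pow]

theorem byte_land_ne_zero {X Y e : ℕ} (h : byte (Nat.land X Y) e ≠ 0) :
    byte X e ≠ 0 ∧ byte Y e ≠ 0 := by
  rw [byte_land] at h
  constructor <;> rintro h0 <;> rw [h0] at h
  · exact h (Nat.zero_and _)
  · exact h (Nat.and_zero _)

theorem byte_lor_ne_zero {X Y e : ℕ} (h : byte (Nat.lor X Y) e ≠ 0) :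
    byte X e ≠ 0 ∨ byte Y e ≠ 0 := by
  by_contra! h'
  rw [byte_lor, h'.1, h'.2] at h
  exact h (Nat.zero_or _)

theorem mod_255_le {n X : ℕ} (h : X < 256 ^ n) : X % 255 ≤ ∑ e ∈ Finset.range n, byte X e := by
  induction n generalizing X with
  | zero => simp_all
  | succ n ih =>
    have hX : X / 256 < 256 ^ n := by
      rw [Nat.div_lt_iff_lt_mul (by norm_num)]; rwa [pow_succ] at h
    have h1 := ih hX
    rw [Finset.sum_range_succ']
    have h2 : ∀ e, byte X (e + 1) = byte (X / 256) e := fun e => by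
      rw [byte_eq, byte_eq, Nat.div_div_eq_div_mul, pow_succ']
    have h3 : byte X 0 = X % 256 := by simp [byte_eq]
    simp only [h2, h3]
    omega

theorem land_mod_255_le {X : ℕ} (m : ℕ) (h : X < 256 ^ 36) :
    Nat.land X m % 255 ≤ ∑ e ∈ Finset.range 36 with byte m e ≠ 0, byte X e := by
  refine (mod_255_le (lt_of_le_of_lt Nat.and_le_left h)).trans ?_
  rw [Finset.sum_filter]
  refine Finset.sum_le_sum fun e _ => ?_
  split_ifs with h0
  · exact (byte_land X m e).trans_le Nat.and_le_left
  · by_contra h1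
    have h2 : byte (Nat.land X m) e ≠ 0 := fun h3 => h1 h3.le
    exact h0 (byte_land_ne_zero h2).2

/-! ### Soundness of the checker -/

/-- `n` lies between `L` and `U`. -/
def Within (n : ℕ → ℕ) (L U : ℕ) : Prop :=
  L < 256 ^ 36 ∧ U < 256 ^ 36 ∧ ∀ e < 36, byte L e ≤ n e ∧ n e ≤ byte U e

/-- The total of `n` over the indices covered by the masks in `T`. -/
def coverSum (n : ℕ → ℕ) (T : Finset ℕ) : ℕ :=
  ∑ e ∈ Finset.range 36 with ∃ p ∈ T, byte p e ≠ 0, n e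

/-- A family of functions of total 24, closed under permutations of the points, which violate
Hall's condition at each arc. -/
structure HallFamily (P : (ℕ → ℕ) → Prop) : Prop where
  total : ∀ {n}, P n → ∑ e ∈ Finset.range 36, n e = 24
  symm : ∀ {n a b}, a < 6 → b < 6 → P n → P fun e => n (swapArc a b e)
  hall : ∀ {n w}, P n → w < 36 → w % 7 ≠ 0 →
    ∃ T ⊆ (cycleMasks w).toFinset, coverSum n T < T.card

theorem lowerSum_le {n : ℕ → ℕ} {L U m : ℕ} {T : Finset ℕ} (hn : Within n L U)
    (hm : ∀ e < 36, byte m e ≠ 0 → ∃ p ∈ T, byte p e ≠ 0) {e : ℕ} (he : e < 36)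
    (hT : ∃ p ∈ T, byte p e ≠ 0) : Nat.land L m % 255 + n e ≤ coverSum n T + byte L e := by
  have h1 := land_mod_255_le m hn.1
  have h2 : ∑ e ∈ Finset.range 36 with byte m e ≠ 0, byte L e ≤
      ∑ e ∈ Finset.range 36 with ∃ p ∈ T, byte p e ≠ 0, byte L e := by
    apply Finset.sum_le_sum_of_subset
    intro e
    simp only [Finset.mem_filter, Finset.mem_range]
    exact fun h => ⟨h.1, hm e h.1 h.2⟩
  have hmem : e ∈ Finset.filter (fun e => ∃ p ∈ T, byte p e ≠ 0) (Finset.range 36) := by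
    simpa using ⟨he, hT⟩
  unfold coverSum
  rw [← Finset.add_sum_erase _ _ hmem] at h2 ⊢
  have h3 : ∑ e ∈ (Finset.filter (fun e => ∃ p ∈ T, byte p e ≠ 0) (Finset.range 36)).erase e,
      byte L e ≤ ∑ e ∈ (Finset.filter (fun e => ∃ p ∈ T, byte p e ≠ 0) (Finset.range 36)).erase e,
      n e := by
    refine Finset.sum_le_sum fun e he' => (hn.2.2 e ?_).1
    simp at he'
    exact he'.2.1
  omega

theorem land_le_coverSum {n : ℕ → ℕ} {L U m : ℕ} {T : Finset ℕ} (hn : Within n L U)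
    (hm : ∀ e < 36, byte m e ≠ 0 → ∃ p ∈ T, byte p e ≠ 0) :
    Nat.land L m % 255 ≤ coverSum n T := by
  refine (land_mod_255_le m hn.1).trans ?_
  refine (Finset.sum_le_sum fun e he => (hn.2.2 e ?_).1).trans
    (Finset.sum_le_sum_of_subset ?_)
  · simp at he
    exact he.1
  · intro e
    simp only [Finset.mem_filter, Finset.mem_range]
    exact fun h => ⟨h.1, hm e h.1 h.2⟩

theorem feasible_of_violation {n : ℕ → ℕ} {L U m c : ℕ} {T : Finset ℕ} (hn : Within n L U)
    (htot : ∑ e ∈ Finset.range 36, n e = 24)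
    (hm : ∀ e < 36, byte m e ≠ 0 → ∃ p ∈ T, byte p e ≠ 0) (hT : coverSum n T < T.card)
    (hc : T.card ≤ c) : feasible (sumTo (byte U) 36) L U m c = true := by
  have h1 := land_le_coverSum hn hm
  have h2 := land_mod_255_le m hn.2.1
  have h3 : ∑ e ∈ Finset.range 36 with ¬ ∃ p ∈ T, byte p e ≠ 0, n e ≤
      ∑ e ∈ Finset.range 36 with ¬ byte m e ≠ 0, byte U e := by
    refine (Finset.sum_le_sum fun e he => (hn.2.2 e ?_).2).trans
      (Finset.sum_le_sum_of_subset ?_)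
    · rw [Finset.mem_filter, Finset.mem_range] at he
      exact he.1
    · intro e
      simp only [Finset.mem_filter, Finset.mem_range]
      exact fun h => ⟨h.1, fun h' => h.2 (hm e h.1 h')⟩
  have h4 := Finset.sum_filter_add_sum_filter_not (Finset.range 36)
    (fun e => ∃ p ∈ T, byte p e ≠ 0) n
  have h5 := Finset.sum_filter_add_sum_filter_not (Finset.range 36)
    (fun e => byte m e ≠ 0) (byte U)
  have h6 := sumTo_eq (byte U) 36
  change coverSum n T + _ = _ at h4
  have h7 : Nat.ble c (Nat.land L m % 255) = false := by
    rw [← Bool.not_eq_true, Nat.ble_eq]; omega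
  have h8 : Nat.ble (25 + Nat.land U m % 255) (c + sumTo (byte U) 36) = true := by
    rw [Nat.ble_eq]; omega
  change (bif Nat.ble c (Nat.land L m % 255) then false
    else Nat.ble (25 + Nat.land U m % 255) (c + sumTo (byte U) 36)) = true
  rw [h7, h8]; rfl

theorem visit_mono {K L U : ℕ} {ps : List ℕ} {m c A g : ℕ} {k : ℕ → ℕ → Bool}
    (h : visit K L U ps m c A g k = true) :
    ∃ A' g', k A' g' = true ∧ g ≤ g' ∧ ∀ e, byte A' e ≠ 0 → byte A e ≠ 0 := by
  induction ps generalizing m c A g k with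
  | nil =>
    simp only [visit, forceNat_eq] at h
    cases hf : feasible K L U m c
    · rw [hf] at h
      exact ⟨A, g, h, le_rfl, fun _ => id⟩
    · rw [hf] at h
      refine ⟨_, _, h, ?_, fun e he => (byte_land_ne_zero he).1⟩
      rw [cond_ble]
      split_ifs with hg
      · exact hg
      · exact le_rfl
  | cons p ps ih =>
    simp only [visit, forceNat_eq] at h
    cases hf : feasible K L U m c
    · rw [hf] at h
      exact ⟨A, g, h, le_rfl, fun _ => id⟩
    · rw [hf] at h
      obtain ⟨A₁, g₁, h₁, hg₁, hA₁⟩ := ih h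
      obtain ⟨A₂, g₂, h₂, hg₂, hA₂⟩ := ih h₁
      exact ⟨A₂, g₂, h₂, hg₁.trans hg₂, fun e he => hA₁ e (hA₂ e he)⟩

theorem visit_sound {n : ℕ → ℕ} {L U : ℕ} {T : Finset ℕ} (hn : Within n L U)
    (htot : ∑ e ∈ Finset.range 36, n e = 24) (hT : coverSum n T < T.card)
    {ps : List ℕ} {m c A g : ℕ} {k : ℕ → ℕ → Bool}
    (hm : ∀ e < 36, byte m e ≠ 0 → ∃ p ∈ T, byte p e ≠ 0)
    (hc : T.card + ps.length ≤ c + (T.filter (· ∈ ps)).card)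
    (h : visit (sumTo (byte U) 36) L U ps m c A g k = true) :
    ∃ A' g', k A' g' = true ∧ 1 ≤ g' ∧
      ∀ e < 36, byte A' e ≠ 0 → n e + 1 ≤ byte L e + g' := by
  induction ps generalizing m c A g k with
  | nil =>
    have hc' : T.card ≤ c := by simpa using hc
    simp only [visit, forceNat_eq, feasible_of_violation hn htot hm hT hc', cond_true] at h
    refine ⟨_, _, h, ?_⟩
    have h1 := land_le_coverSum hn hm
    have hg : c - Nat.land L m % 255 ≤ bif Nat.ble g (Nat.sub c (Nat.mod (Nat.land L m) 255)) then
        Nat.sub c (Nat.mod (Nat.land L m) 255) else g := by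
      rw [cond_ble]
      split_ifs with hg
      · exact le_rfl
      · exact (not_le.1 hg).le
    refine ⟨le_trans (by omega) hg, fun e he hA => ?_⟩
    have h2 := lowerSum_le hn hm he (hm e he (byte_land_ne_zero hA).2)
    omega
  | cons p ps ih =>
    have hcard : (T.filter (· ∈ p :: ps)).card ≤ (p :: ps).length :=
      (Finset.card_le_card fun x hx => by simp at hx ⊢; exact hx.2).trans
        (List.toFinset_card_le (p :: ps))
    have hle : (T.filter (· ∈ p :: ps)).card ≤ T.card := Finset.card_filter_le _ _
    have hc' : T.card ≤ c := by omega
    simp only [visit, forceNat_eq, feasible_of_violation hn htot hm hT hc', cond_true] at h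
    by_cases hp : p ∈ T
    · obtain ⟨A₁, g₁, h₁, -, -⟩ := visit_mono h
      refine ih ?_ ?_ h₁
      · intro e he hb
        rcases byte_lor_ne_zero hb with hb | hb
        · exact hm e he hb
        · exact ⟨p, hp, hb⟩
      · have : (T.filter (· ∈ p :: ps)).card ≤ (T.filter (· ∈ ps)).card + 1 := by
          refine (Finset.card_le_card (t := insert p (T.filter (· ∈ ps))) ?_).trans
            (Finset.card_insert_le _ _)
          intro x
          simp only [Finset.mem_filter, List.mem_cons, Finset.mem_insert]
          rintro ⟨hx, rfl | hx'⟩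
          exacts [Or.inl rfl, Or.inr ⟨hx, hx'⟩]
        simp only [List.length_cons] at hc
        omega
    · have hfil : T.filter (· ∈ p :: ps) = T.filter (· ∈ ps) := by
        apply Finset.filter_congr
        intro x hx
        have : x ≠ p := fun h => hp (h ▸ hx)
        simp [this]
      rw [hfil] at hc hle
      simp only [List.length_cons] at hc
      have hc₁ : T.card + ps.length ≤ Nat.sub c 1 + (T.filter (· ∈ ps)).card := by
        change _ ≤ c - 1 + _
        omega
      obtain ⟨A₁, g₁, h₁, hg₁, hA₁⟩ := ih hm hc₁ h
      obtain ⟨A₂, g₂, h₂, hg₂, hA₂⟩ := visit_mono h₁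
      exact ⟨A₂, g₂, h₂, hg₁.trans hg₂, fun e he hb =>
        (hA₁ e he (hA₂ e hb)).trans (Nat.add_le_add_left hg₂ _)⟩

theorem isDead_eq_false {n : ℕ → ℕ} {L U : ℕ} (hn : Within n L U)
    (htot : ∑ e ∈ Finset.range 36, n e = 24) : isDead L U = false := by
  have h1 : Nat.ble 24 (sumTo (byte U) 36) = true := by
    rw [Nat.ble_eq, sumTo_eq, ← htot]
    exact Finset.sum_le_sum fun e he => (hn.2.2 e (Finset.mem_range.1 he)).2
  have h2 : sumTo (fun e => Nat.sub (byte L e) (byte U e)) 36 = 0 := by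
    rw [sumTo_eq]
    refine Finset.sum_eq_zero fun e he => Nat.sub_eq_zero_of_le ?_
    have := hn.2.2 e (Finset.mem_range.1 he)
    omega
  rw [isDead, h1, h2]
  rfl

theorem mem_pushState {n : ℕ → ℕ} {L U : ℕ} (hn : Within n L U)
    (htot : ∑ e ∈ Finset.range 36, n e = 24) (stk : List (ℕ × ℕ)) :
    (L, U) ∈ pushState L U stk := by
  rw [pushState, isDead_eq_false hn htot]
  exact List.mem_cons_self

theorem subset_pushState (L U : ℕ) (stk : List (ℕ × ℕ)) : stk ⊆ pushState L U stk := by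
  rw [pushState]
  cases isDead L U
  · exact List.subset_cons_self _ _
  · exact fun _ => id

theorem swapNat_eq (a b x : ℕ) : swapNat a b x = Equiv.swap a b x := by
  simp only [swapNat, Equiv.swap_apply_def, Bool.cond_eq_ite, Nat.beq_eq]

theorem swapArc_lt {a b e : ℕ} (ha : a < 6) (hb : b < 6) (he : e < 36) : swapArc a b e < 36 := by
  have h : ∀ x < 6, swapNat a b x < 6 := by
    intro x hx
    rw [swapNat_eq, Equiv.swap_apply_def]
    split_ifs <;> assumption
  have h1 := h (e / 6) (by omega)
  have h2 := h (e % 6) (by omega)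
  change 6 * swapNat a b (e / 6) + swapNat a b (e % 6) < 36
  omega

theorem swapArc_swapArc {a b e : ℕ} (ha : a < 6) (hb : b < 6) :
    swapArc a b (swapArc a b e) = e := by
  have h : ∀ x < 6, swapNat a b x < 6 := by
    intro x hx
    rw [swapNat_eq, Equiv.swap_apply_def]
    split_ifs <;> assumption
  have h2 := h (e % 6) (by omega)
  change 6 * swapNat a b ((6 * swapNat a b (e / 6) + swapNat a b (e % 6)) / 6) +
    swapNat a b ((6 * swapNat a b (e / 6) + swapNat a b (e % 6)) % 6) = e
  rw [show (6 * swapNat a b (e / 6) + swapNat a b (e % 6)) / 6 = swapNat a b (e / 6) by omega,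
    show (6 * swapNat a b (e / 6) + swapNat a b (e % 6)) % 6 = swapNat a b (e % 6) by omega]
  simp only [swapNat_eq, Equiv.swap_apply_self]
  omega

theorem byte_swapArc_of_isSymm {a b X e : ℕ} (h : isSymm a b X = true) (he : e < 36) :
    byte X (swapArc a b e) = byte X e := by
  rw [isSymm, Nat.beq_eq, sumTo_eq, eq_comm, Finset.sum_eq_zero_iff] at h
  have := h e (Finset.mem_range.2 he)
  rw [cond_beq] at this
  by_contra hne
  simp [hne] at this

theorem orbit_succ (mask L U O n : ℕ) : orbit mask L U O (n + 1) =
    bif Nat.beq (mask / 2 ^ (n % 36) % 2) 0 then orbit mask L U O n else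
      orbitStep (n % 36 / 6) (n % 6) L U (orbit mask L U O n) := by
  conv_rhs => rw [← forceNat_eq (orbit mask L U O n) (orbitStep (n % 36 / 6) (n % 6) L U),
    ← forceNat_eq (n % 6) fun b =>
      forceNat (orbit mask L U O n) (orbitStep (n % 36 / 6) b L U),
    ← forceNat_eq (n % 36 / 6) fun a => forceNat (n % 6) fun b =>
      forceNat (orbit mask L U O n) (orbitStep a b L U)]
  rfl

theorem orbit_sound {P : (ℕ → ℕ) → Prop} (hP : HallFamily P) {L U e₀ mid mask : ℕ} (N : ℕ)
    {v : ℕ} (hv : v < 36) (hb : byte (orbit mask L U (256 ^ e₀) N) v ≠ 0) (he₀ : e₀ < 36)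
    {n : ℕ → ℕ} (hn : P n) (hw : Within n L U) (hmid : mid ≤ n v) :
    ∃ n', P n' ∧ Within n' L U ∧ mid ≤ n' e₀ := by
  induction N generalizing v n with
  | zero =>
    refine ⟨n, hn, hw, ?_⟩
    have : v = e₀ := by
      by_contra hne
      apply hb
      change 256 ^ e₀ / 256 ^ v % 256 = 0
      rcases Nat.lt_or_gt_of_ne hne with h | h
      · obtain ⟨d, rfl⟩ := Nat.exists_eq_add_of_lt h
        rw [show 256 ^ (v + d + 1) = 256 ^ v * (256 * 256 ^ d) by ring,
          Nat.mul_div_cancel_left _ (by positivity), Nat.mul_mod_right]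
      · rw [Nat.div_eq_of_lt (Nat.pow_lt_pow_right (by norm_num) h)]
    exact this ▸ hmid
  | succ N ih =>
    rw [orbit_succ, cond_beq] at hb
    split_ifs at hb with hbit
    · exact ih hv hb hn hw hmid
    have ha : N % 36 / 6 < 6 := by omega
    have hb' : N % 6 < 6 := by omega
    rw [orbitStep] at hb
    cases hL : isSymm (N % 36 / 6) (N % 6) L
    · rw [hL, cond_false] at hb
      exact ih hv hb hn hw hmid
    cases hU : isSymm (N % 36 / 6) (N % 6) U
    · rw [hL, hU, cond_true, cond_false] at hb
      exact ih hv hb hn hw hmid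
    rw [hL, hU, cond_true, cond_true, byte_pack _ hv] at hb
    by_cases h1 : byte (orbit mask L U (256 ^ e₀) N) v = 0
    · refine ih (v := swapArc (N % 36 / 6) (N % 6) v) (swapArc_lt ha hb' hv) ?_
        (hP.symm ha hb' hn) ⟨hw.1, hw.2.1, fun e he => ?_⟩ ?_
      · intro h2
        rw [h1, h2] at hb
        exact hb rfl
      · have := hw.2.2 _ (swapArc_lt ha hb' he)
        rwa [byte_swapArc_of_isSymm hL he, byte_swapArc_of_isSymm hU he] at this
      · rwa [swapArc_swapArc ha hb']
    · exact ih hv h1 hn hw hmid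

theorem within_lowerUpper {n : ℕ → ℕ} {L U A g : ℕ} (hn : Within n L U)
    (h : ∀ e < 36, byte A e ≠ 0 → n e + 1 ≤ byte L e + g) :
    Within n L (lowerUpper L U A g) := by
  refine ⟨hn.1, pack_lt _, fun e he => ⟨(hn.2.2 e he).1, ?_⟩⟩
  have h1 := hn.2.2 e he
  have h2 := byte_lt U e
  have h3 := h e he
  rw [lowerUpper, byte_pack_of_lt _ he]
  all_goals
    simp only [forceNat_eq, cond_beq, cond_ble]
    split_ifs with h4 h5
  · exact h1.2
  · exact h1.2
  · have := h3 h4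
    change n e ≤ byte L e + g - 1
    omega
  · exact h2
  · exact h2
  · exact (not_le.1 h5).trans h2

/-- A successful refutation shows that no member of the family lies in a state on the stack. -/
theorem not_within_of_refute {P : (ℕ → ℕ) → Prop} (hP : HallFamily P) {ds : List ℕ}
    {stk : List (ℕ × ℕ)} (h : refute ds stk = true) {s : ℕ × ℕ} (hs : s ∈ stk)
    {n : ℕ → ℕ} (hn : P n) : ¬ Within n s.1 s.2 := by
  induction ds generalizing stk s n with
  | nil =>
    cases stk with
    | nil => simp at hs
    | cons => simp [refute] at h
  | cons d ds ih =>
    cases stk with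
    | nil => simp at hs
    | cons s₀ stk =>
      simp only [refute, forceNat_eq] at h
      intro hw
      cases hd : Nat.ble 36 d
      · rw [hd, cond_false] at h
        have hd' : d < 36 := by
          rw [← Bool.not_eq_true, Nat.ble_eq] at hd; omega
        cases h7 : Nat.beq (Nat.mod d 7) 0
        swap
        · rw [h7, cond_true] at h
          exact Bool.false_ne_true h
        rw [h7, cond_false] at h
        have h7' : d % 7 ≠ 0 := by
          intro h0
          rw [show Nat.mod d 7 = 0 from h0] at h7
          exact absurd h7 (by decide)
        rcases List.mem_cons.1 hs with rfl | hs
        · have htot := hP.total hn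
          obtain ⟨T, hTs, hT⟩ := hP.hall hn hd' h7'
          have hfil : T.filter (· ∈ cycleMasks d) = T :=
            Finset.filter_true_of_mem fun x hx => List.mem_toFinset.1 (hTs hx)
          obtain ⟨A, g, hk, hg, hA⟩ := visit_sound hw htot hT
            (fun e _ h0 => absurd (by simp [byte_eq]) h0)
            (by rw [hfil, add_comm]) h
          have hg' : Nat.beq g 0 = false := by
            rw [← Bool.not_eq_true, Nat.beq_eq]; omega
          simp only [hg', cond_false] at hk
          have hw' := within_lowerUpper hw hA
          exact ih hk (mem_pushState hw' htot stk) hn hw'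
        · obtain ⟨A, g, hk, -, -⟩ := visit_mono h
          cases hg : Nat.beq g 0
          · simp only [hg, cond_false] at hk
            exact ih hk (subset_pushState _ _ _ hs) hn hw
          · simp only [hg, cond_true] at hk
            exact ih hk hs hn hw
      · rw [hd, cond_true] at h
        rcases List.mem_cons.1 hs with rfl | hs
        · have htot := hP.total hn
          have hmid : d / 36 % 8 < 8 := Nat.mod_lt _ (by norm_num)
          have he : d % 36 < 36 := Nat.mod_lt _ (by norm_num)
          by_cases hex : ∃ v < 36, byte (orbit (d / 288) s.1 s.2 (256 ^ (d % 36)) 72) v ≠ 0 ∧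
              d / 36 % 8 ≤ n v
          · obtain ⟨v, hv, hb, hle⟩ := hex
            obtain ⟨n', hn', hw', hle'⟩ := orbit_sound hP 72 hv hb he hn hw hle
            have hhi : Within n' (pack fun v => bif Nat.beq v (Nat.mod d 36) then
                Nat.mod (Nat.div d 36) 8 else byte s.1 v) s.2 := by
              refine ⟨pack_lt _, hw'.2.1, fun e he' => ⟨?_, (hw'.2.2 e he').2⟩⟩
              refine (byte_pack _ he').trans_le ((Nat.mod_le _ _).trans ?_)
              rw [cond_beq]
              split_ifs with h0
              · rw [h0]; exact hle'
              · exact (hw'.2.2 e he').1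
            exact ih h (mem_pushState hhi (hP.total hn') _) hn' hhi
          · push Not at hex
            have hlo : Within n s.1 (pack fun v => bif Nat.beq (byte (orbit (Nat.div d 288) s.1 s.2
                (Nat.pow 256 (Nat.mod d 36)) 72) v) 0 then byte s.2 v
                else Nat.sub (Nat.mod (Nat.div d 36) 8) 1) := by
              refine ⟨hw.1, pack_lt _, fun e he' => ⟨(hw.2.2 e he').1, ?_⟩⟩
              have h1 := hex e he'
              rw [byte_pack_of_lt _ he']
              all_goals
                rw [cond_beq]
                split_ifs with h0
              · exact (hw.2.2 e he').2
              · have := h1 h0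
                change n e ≤ d / 36 % 8 - 1
                omega
              · exact byte_lt _ _
              · change d / 36 % 8 - 1 < 256
                omega
            exact ih h (subset_pushState _ _ _ (mem_pushState hlo htot stk)) hn hlo
        · exact ih h (subset_pushState _ _ _ (subset_pushState _ _ _ hs)) hn hw

/-! ### Rotations and corners -/

/-- Ordered triples of faces or colors. -/
abbrev Triple := Fin 6 × Fin 6 × Fin 6

/-- The set of ordered triples of faces meeting at a corner and read clockwise, with the triple
`(x, y, z)` encoded as bit `36 * x + 6 * y + z`. -/
def cornerBits : ℕ := 206491661311056565559477280458748089162174568026204679404847360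

/-- Whether the faces `x, y, z` meet at a corner and are read clockwise. -/
def isCornerNat (x y z : ℕ) : Bool :=
  Nat.beq (Nat.mod (Nat.div cornerBits
    (Nat.pow 2 (Nat.add (Nat.mul 36 x) (Nat.add (Nat.mul 6 y) z)))) 2) 1

/-- Whether the triple `t` of faces is a corner read clockwise. -/
def isCorner (t : Triple) : Bool := isCornerNat t.1.val t.2.1.val t.2.2.val

/-- The image of a triple under a permutation. -/
def permTriple (g : Equiv.Perm (Fin 6)) (t : Triple) : Triple := (g t.1, g t.2.1, g t.2.2)

theorem permTriple_mul (g h : Equiv.Perm (Fin 6)) (t : Triple) :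
    permTriple (g * h) t = permTriple g (permTriple h t) := rfl

theorem permTriple_one (t : Triple) : permTriple 1 t = t := rfl

theorem permTriple_inv_self (g : Equiv.Perm (Fin 6)) (t : Triple) :
    permTriple g⁻¹ (permTriple g t) = t := by
  rw [← permTriple_mul, inv_mul_cancel, permTriple_one]

theorem permTriple_self_inv (g : Equiv.Perm (Fin 6)) (t : Triple) :
    permTriple g (permTriple g⁻¹ t) = t := by
  rw [← permTriple_mul, mul_inv_cancel, permTriple_one]

theorem isCorner_cyc : ∀ t : Triple, isCorner (cyc t) = isCorner t := by decide +kernel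

theorem isCorner_r1 : ∀ t : Triple, isCorner (permTriple r1 t) = isCorner t := by
  decide +kernel

theorem isCorner_r2 : ∀ t : Triple, isCorner (permTriple r2 t) = isCorner t := by
  decide +kernel

theorem exists_rotation_of_isCorner : ∀ t : Triple, isCorner t = true →
    ∃ i j k : Fin 4, t = permTriple (r1 ^ i.val * r2 ^ j.val * r1 ^ k.val) (0, 1, 2) := by
  decide +kernel

/-- The permutations preserving the corners and the opposite pairs of faces. -/
def cornerStabilizer : Subgroup (Equiv.Perm (Fin 6)) where
  carrier := {g | (∀ t, isCorner (permTriple g t) = isCorner t) ∧ ∀ i, g (i + 3) = g i + 3}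
  one_mem' := ⟨fun _ => rfl, fun _ => rfl⟩
  mul_mem' := fun {g h} hg hh =>
    ⟨fun t => by rw [permTriple_mul, hg.1, hh.1], fun i => by
      rw [Equiv.Perm.mul_apply, hh.2, hg.2, Equiv.Perm.mul_apply]⟩
  inv_mem' := fun {g} hg =>
    ⟨fun t => by rw [← hg.1, permTriple_self_inv], fun i => by
      rw [Equiv.Perm.inv_eq_iff_eq, hg.2]
      exact congrArg (· + 3) (g.apply_symm_apply i).symm⟩

theorem G_le_cornerStabilizer : G ≤ cornerStabilizer := by
  rw [G, Subgroup.closure_le]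
  rintro g (rfl | rfl)
  · exact ⟨isCorner_r1, by decide +kernel⟩
  · exact ⟨isCorner_r2, by decide +kernel⟩

theorem isCorner_permTriple {g : Equiv.Perm (Fin 6)} (hg : g ∈ G) (t : Triple) :
    isCorner (permTriple g t) = isCorner t :=
  (G_le_cornerStabilizer hg).1 t

theorem exists_mem_G_of_isCorner {t : Triple} (h : isCorner t = true) :
    ∃ g ∈ G, t = permTriple g (0, 1, 2) := by
  obtain ⟨i, j, k, h⟩ := exists_rotation_of_isCorner t h
  have h1 : r1 ∈ G := Subgroup.subset_closure (by simp)
  have h2 : r2 ∈ G := Subgroup.subset_closure (by simp)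
  exact ⟨_, mul_mem (mul_mem (pow_mem h1 _) (pow_mem h2 _)) (pow_mem h1 _), h⟩

/-- A decision procedure for membership in the rotation group. -/
def isRotation (g : Fin 6 → Fin 6) : Bool :=
  isCorner (g 0, g 1, g 2) &&
    (Nat.beq (g 3).val (g 0 + 3).val &&
      (Nat.beq (g 4).val (g 1 + 3).val && Nat.beq (g 5).val (g 2 + 3).val))

theorem mem_G_iff (g : Equiv.Perm (Fin 6)) : g ∈ G ↔ isRotation g = true := by
  simp only [isRotation, Bool.and_eq_true, Nat.beq_eq, ← Fin.ext_iff]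
  constructor
  · intro hg
    have h := (G_le_cornerStabilizer hg).2
    exact ⟨(isCorner_permTriple hg (0, 1, 2)).trans (by decide +kernel), h 0, h 1, h 2⟩
  · rintro ⟨hc, h3, h4, h5⟩
    obtain ⟨k, hk, hgk⟩ := exists_mem_G_of_isCorner hc
    have h := (G_le_cornerStabilizer hk).2
    simp only [permTriple, Prod.mk.injEq] at hgk
    obtain ⟨h0, h1, h2⟩ := hgk
    suffices g = k from this ▸ hk
    ext i : 1
    fin_cases i
    · exact h0
    · exact h1
    · exact h2
    · exact h3.trans ((congrArg (· + 3) h0).trans (h 0).symm)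
    · exact h4.trans ((congrArg (· + 3) h1).trans (h 1).symm)
    · exact h5.trans ((congrArg (· + 3) h2).trans (h 2).symm)

/-- Whether the triple `t` of colors is a corner of the cube `x` read clockwise. -/
def cubeCorner (x : CCube) (t : Triple) : Bool := isCorner (permTriple x⁻¹ t)

theorem cubeCorner_mul (σ x : CCube) (t : Triple) :
    cubeCorner (σ * x) (permTriple σ t) = cubeCorner x t := by
  rw [cubeCorner, mul_inv_rev, permTriple_mul, permTriple_inv_self, cubeCorner]

theorem cubeCorner_congr {x y : CCube} (h : x⁻¹ * y ∈ G) (t : Triple) :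
    cubeCorner x t = cubeCorner y t := by
  rw [cubeCorner, cubeCorner, ← isCorner_permTriple h (permTriple y⁻¹ t), ← permTriple_mul,
    mul_assoc, mul_inv_cancel, mul_one]

theorem cubeCorner_of_cycClass_eq {x : CCube} {t u : Triple} (h : cycClass t = cycClass u) :
    cubeCorner x t = cubeCorner x u := by
  have ht : t ∈ cycClass u := h ▸ by simp [cycClass]
  have hc : ∀ v, cubeCorner x (cyc v) = cubeCorner x v := fun v => isCorner_cyc (permTriple x⁻¹ v)
  simp only [cycClass, Finset.mem_insert, Finset.mem_singleton] at ht
  rcases ht with rfl | rfl | rfl <;> simp only [hc]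

theorem mem_cornerTriples {x : CCube} {s : Finset Triple} :
    s ∈ cornerTriples x ↔ ∃ t, cubeCorner x t = true ∧ s = cycClass t := by
  simp only [cornerTriples, Finset.mem_filter, Finset.mem_univ, true_and]
  constructor
  · rintro ⟨g, hg, rfl⟩
    refine ⟨permTriple x (permTriple g (0, 1, 2)), ?_, rfl⟩
    rw [cubeCorner, permTriple_inv_self, isCorner_permTriple hg]
    decide +kernel
  · rintro ⟨t, ht, rfl⟩
    obtain ⟨g, hg, h⟩ := exists_mem_G_of_isCorner ht
    refine ⟨g, hg, ?_⟩
    change _ = cycClass (permTriple x (permTriple g (0, 1, 2)))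
    rw [← h, permTriple_self_inv]

theorem cycClass_mem_cornerTriples {x : CCube} {t : Triple} :
    cycClass t ∈ cornerTriples x ↔ cubeCorner x t = true := by
  rw [mem_cornerTriples]
  constructor
  · rintro ⟨u, hu, h⟩
    rwa [cubeCorner_of_cycClass_eq h]
  · exact fun h => ⟨t, h, rfl⟩

/-! ### Varieties and arcs -/

/-- Row `6 * a + b` lists the values of the involution `syn a b`. -/
def synCodes : List ℕ :=
  [12345, 345012, 421503, 103254, 250431, 534120, 345012, 12345, 230154, 521430, 104523, 453201,
    421503, 230154, 12345, 354021, 543210, 105432, 103254, 521430, 354021, 12345, 435102, 240513,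
    250431, 104523, 543210, 435102, 12345, 321054, 534120, 453201, 105432, 240513, 321054, 12345]

/-- The value at `x` of the involution `syn a b`. -/
def synNat (a b x : ℕ) : ℕ :=
  Nat.mod (Nat.div (synCodes.getD (Nat.add (Nat.mul 6 a) b) 0) (Nat.pow 10 (Nat.sub 5 x))) 10

theorem synNat_lt : ∀ a b x : Fin 6, synNat a b x < 6 := by decide +kernel

theorem synNat_synNat : ∀ a b x : Fin 6, synNat a b (synNat a b x) = x := by decide +kernel

/-- The image of the transposition of `a` and `b` under an outer automorphism of `S₆`. -/
def syn (a b : Fin 6) : Equiv.Perm (Fin 6) :=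
  Function.Involutive.toPerm (fun x => ⟨synNat a b x, synNat_lt a b x⟩)
    fun x => Fin.ext (synNat_synNat a b x)

/-- A cube whose variety corresponds to the arc `p`. -/
def model (p : Fin 6 × Fin 6) : CCube := syn 0 p.1 * syn 1 (Equiv.swap 0 p.1 p.2)

/-- The arc `p` after the transposition of `a` and `b`. -/
def swapPair (a b : Fin 6) (p : Fin 6 × Fin 6) : Fin 6 × Fin 6 :=
  (Equiv.swap a b p.1, Equiv.swap a b p.2)

theorem syn_inv (a b : Fin 6) : (syn a b)⁻¹ = syn a b := by
  rw [inv_eq_iff_mul_eq_one]; ext x : 1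
  exact Fin.ext (synNat_synNat a b x)

/-- The inverse of a model of the arc `p`. -/
theorem inv_model (p : Fin 6 × Fin 6) :
    (model p)⁻¹ = syn 1 (Equiv.swap 0 p.1 p.2) * syn 0 p.1 := by
  rw [model, mul_inv_rev, syn_inv, syn_inv]

theorem isRotation_syn : ∀ (a b : Fin 6) (p : Fin 6 × Fin 6), p.1 ≠ p.2 →
    isRotation (⇑(syn 1 (Equiv.swap 0 (swapPair a b p).1 (swapPair a b p).2) *
      syn 0 (swapPair a b p).1) ∘ syn a b ∘ syn 0 p.1 ∘ syn 1 (Equiv.swap 0 p.1 p.2)) = true := by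
  decide +kernel

theorem eq_of_isRotation : ∀ p q : Fin 6 × Fin 6, p.1 ≠ p.2 → q.1 ≠ q.2 →
    isRotation (⇑(syn 1 (Equiv.swap 0 p.1 p.2)) ∘ syn 0 p.1 ∘ syn 0 q.1 ∘
      syn 1 (Equiv.swap 0 q.1 q.2)) = true → p = q := by
  decide +kernel

theorem swap_eq_mul_syn : ∀ i j : Fin 6, i ≠ j → ∃ c d : Fin 6,
    ∀ x, Equiv.swap i j x = syn 0 (syn i j 0) (syn c (syn i j c) (syn d (syn i j d) x)) := by
  decide +kernel

theorem model_mul_mem (a b : Fin 6) {p : Fin 6 × Fin 6} (hp : p.1 ≠ p.2) :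
    (model (swapPair a b p))⁻¹ * (syn a b * model p) ∈ G := by
  rw [mem_G_iff, inv_model]
  exact isRotation_syn a b p hp

theorem eq_of_model_mem {p q : Fin 6 × Fin 6} (hp : p.1 ≠ p.2) (hq : q.1 ≠ q.2)
    (h : (model p)⁻¹ * model q ∈ G) : p = q := by
  rw [mem_G_iff, inv_model] at h
  exact eq_of_isRotation p q hp hq h

theorem swapPair_ne {a b : Fin 6} {p : Fin 6 × Fin 6} (hp : p.1 ≠ p.2) :
    (swapPair a b p).1 ≠ (swapPair a b p).2 :=
  (Equiv.swap a b).injective.ne hp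

theorem exists_model_syn_mul {a b : Fin 6} {x : CCube}
    (h : ∃ p : Fin 6 × Fin 6, p.1 ≠ p.2 ∧ (model p)⁻¹ * x ∈ G) :
    ∃ p : Fin 6 × Fin 6, p.1 ≠ p.2 ∧ (model p)⁻¹ * (syn a b * x) ∈ G := by
  obtain ⟨p, hp, hx⟩ := h
  refine ⟨swapPair a b p, swapPair_ne hp, ?_⟩
  rw [← mul_inv_cancel_left (model p) x, ← mul_assoc (syn a b), ← mul_assoc]
  exact mul_mem (model_mul_mem a b hp) hx

theorem exists_model (x : CCube) : ∃ p : Fin 6 × Fin 6, p.1 ≠ p.2 ∧ (model p)⁻¹ * x ∈ G := by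
  induction x using Equiv.Perm.swap_induction_on with
  | one =>
    refine ⟨(0, 1), by decide, ?_⟩
    rw [mem_G_iff]
    decide +kernel
  | swap_mul f i j hij hf =>
    obtain ⟨c, d, h⟩ := swap_eq_mul_syn i j hij
    have h' : Equiv.swap i j = syn 0 (syn i j 0) * (syn c (syn i j c) * syn d (syn i j d)) :=
      Equiv.ext h
    rw [h', mul_assoc, mul_assoc]
    exact exists_model_syn_mul (exists_model_syn_mul (exists_model_syn_mul hf))

/-- The arc corresponding to the variety of `x`. -/
noncomputable def arcOf (x : CCube) : Fin 6 × Fin 6 := (exists_model x).choose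

theorem arcOf_ne (x : CCube) : (arcOf x).1 ≠ (arcOf x).2 := (exists_model x).choose_spec.1

theorem model_arcOf (x : CCube) : (model (arcOf x))⁻¹ * x ∈ G := (exists_model x).choose_spec.2

theorem arcOf_eq {x : CCube} {p : Fin 6 × Fin 6} (hp : p.1 ≠ p.2) (h : (model p)⁻¹ * x ∈ G) :
    arcOf x = p := by
  refine eq_of_model_mem (arcOf_ne x) hp ?_
  have := mul_mem (model_arcOf x) (inv_mem h)
  rwa [mul_inv_rev, inv_inv, mul_assoc, mul_inv_cancel_left] at this

theorem arcOf_syn_mul (a b : Fin 6) (x : CCube) :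
    arcOf (syn a b * x) = swapPair a b (arcOf x) := by
  refine arcOf_eq (swapPair_ne (arcOf_ne x)) ?_
  have := mul_mem (model_mul_mem a b (arcOf_ne x)) (model_arcOf x)
  rwa [mul_assoc, mul_assoc, mul_inv_cancel_left] at this

/-- The index of an arc. -/
def arcIndex (p : Fin 6 × Fin 6) : ℕ := 6 * p.1.val + p.2.val

theorem arcIndex_lt (p : Fin 6 × Fin 6) : arcIndex p < 36 := by
  unfold arcIndex; omega

theorem arcIndex_mod {p : Fin 6 × Fin 6} (hp : p.1 ≠ p.2) : arcIndex p % 7 ≠ 0 := by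
  have := Fin.val_ne_of_ne hp
  unfold arcIndex; omega

theorem exists_arcIndex_eq {w : ℕ} (hw : w < 36) : ∃ p, arcIndex p = w :=
  ⟨(⟨w / 6, by omega⟩, ⟨w % 6, by omega⟩), by simp only [arcIndex]; omega⟩

theorem arcIndex_swapPair : ∀ (a b : Fin 6) (p : Fin 6 × Fin 6),
    arcIndex (swapPair a b p) = swapArc a b (arcIndex p) := by
  decide +kernel

/-- Whether `t` is a corner triple of the model of the arc of index `e`. -/
def modelCorner (e : ℕ) (t : Triple) : Bool :=
  forceNat (Nat.div e 6) fun a =>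
  forceNat (swapNat 0 a (Nat.mod e 6)) fun b =>
    isCornerNat (synNat 1 b (synNat 0 a t.1.val)) (synNat 1 b (synNat 0 a t.2.1.val))
      (synNat 1 b (synNat 0 a t.2.2.val))

theorem inv_model_val : ∀ (p : Fin 6 × Fin 6) (x : Fin 6),
    (syn 1 (Equiv.swap 0 p.1 p.2) (syn 0 p.1 x)).val =
      synNat 1 (swapNat 0 (arcIndex p / 6) (arcIndex p % 6)) (synNat 0 (arcIndex p / 6) x) := by
  decide +kernel

theorem cubeCorner_model (p : Fin 6 × Fin 6) (t : Triple) :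
    cubeCorner (model p) t = modelCorner (arcIndex p) t := by
  rw [cubeCorner, inv_model]
  simp only [modelCorner, forceNat_eq]
  simp only [isCorner, permTriple, Equiv.Perm.mul_apply, inv_model_val]
  rfl

/-- The packed indicator of the arcs having `t` as a corner triple. -/
def cornerMask (t : Triple) : ℕ :=
  pack fun e => bif Nat.beq (Nat.mod e 7) 0 then 0 else bif modelCorner e t then 255 else 0

theorem byte_cornerMask {p : Fin 6 × Fin 6} (hp : p.1 ≠ p.2) (t : Triple) :
    byte (cornerMask t) (arcIndex p) ≠ 0 ↔ cubeCorner (model p) t = true := by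
  have h7 : ¬ Nat.mod (arcIndex p) 7 = 0 := arcIndex_mod hp
  rw [cornerMask, byte_pack _ (arcIndex_lt p), cond_beq, if_neg h7, cubeCorner_model]
  cases modelCorner (arcIndex p) t <;> decide

theorem cubeCorner_arcOf (x : CCube) (t : Triple) :
    cubeCorner x t = true ↔ byte (cornerMask t) (arcIndex (arcOf x)) ≠ 0 := by
  rw [byte_cornerMask (arcOf_ne x), cubeCorner_congr (model_arcOf x)]

theorem all_cornerMask_mem : ∀ t : Triple, forceNat (cornerMask t) (fun m =>
    (List.range 36).all fun e => Nat.beq (Nat.mod e 7) 0 || (!modelCorner e t ||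
      (cycleMasks e).any (Nat.beq m))) = true := by
  decide +kernel

theorem cornerMask_mem {p : Fin 6 × Fin 6} (hp : p.1 ≠ p.2) {t : Triple}
    (h : cubeCorner (model p) t = true) : cornerMask t ∈ cycleMasks (arcIndex p) := by
  have h1 := all_cornerMask_mem t
  rw [forceNat_eq, List.all_eq_true] at h1
  have h2 := h1 _ (List.mem_range.2 (arcIndex_lt p))
  rw [← cubeCorner_model, h] at h2
  simp only [Bool.or_eq_true, Nat.beq_eq, Bool.not_true, Bool.false_eq_true, false_or,
    List.any_eq_true] at h2
  rcases h2 with h2 | ⟨m, hm, h2⟩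
  · exact absurd h2 (arcIndex_mod hp)
  · exact h2 ▸ hm

/-- Whether `u` is a cyclic rotation of `t`. -/
def isCyc (t u : Triple) : Bool :=
  decide (t = u) || (decide (t = cyc u) || decide (t = cyc (cyc u)))

theorem all_cornerMask_separates : ∀ t : Triple, cornerMask t = 0 ∨
    forceNat (cornerMask t) (fun m => decide (∀ u : Triple, isCyc t u = true ∨
      (List.range 36).any (fun e => !Nat.beq (Nat.mod e 7) 0 &&
        (modelCorner e u != !Nat.beq (byte m e) 0)) = true)) = true := by
  decide +kernel

theorem cycClass_eq_of_isCyc {t u : Triple} (h : isCyc t u = true) : cycClass t = cycClass u := by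
  simp only [isCyc, Bool.or_eq_true, decide_eq_true_eq] at h
  rcases h with rfl | rfl | rfl <;> ext v <;>
    simp only [cycClass, cyc, Finset.mem_insert, Finset.mem_singleton] <;> tauto

theorem cycClass_eq_of_cornerMask_eq {x : CCube} {t u : Triple} (ht : cubeCorner x t = true)
    (h : cornerMask t = cornerMask u) : cycClass t = cycClass u := by
  have h0 : cornerMask t ≠ 0 := fun h0 => by
    rw [cubeCorner_arcOf, h0] at ht
    exact ht (by simp [byte_eq])
  have h1 := (all_cornerMask_separates t).resolve_left h0
  rw [forceNat_eq, decide_eq_true_eq] at h1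
  refine (h1 u).elim cycClass_eq_of_isCyc fun h2 => ?_
  exfalso
  simp only [List.any_eq_true, List.mem_range, Bool.and_eq_true] at h2
  obtain ⟨e, he, h7, h2⟩ := h2
  have h7' : ¬ Nat.mod e 7 = 0 := fun h0 => by
    rw [h0] at h7
    exact absurd h7 (by decide)
  rw [h, cornerMask, byte_pack _ he, cond_beq, if_neg h7'] at h2
  revert h2
  cases modelCorner e u <;> decide

/-! ### Hall's condition -/

/-- Hall's condition fails for the corner triples of every variety. -/
def Blocked (S : Multiset CCube) : Prop :=
  ∀ w, ∃ T ⊆ cornerTriples w,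
    S.countP (fun x => ∃ t ∈ T, t ∈ cornerTriples x) < T.card

theorem blocked_of_not_hasCornerSolution {S : Multiset CCube} (h : ¬ HasCornerSolution S) :
    Blocked S := by
  intro w
  by_contra! hw
  refine h ⟨w, ?_⟩
  let F : {t // t ∈ cornerTriples w} → Finset S.ToType := fun t =>
    Finset.univ.filter fun i => t.1 ∈ cornerTriples i.1
  have hF : ∀ s : Finset {t // t ∈ cornerTriples w}, s.card ≤ (s.biUnion F).card := by
    intro s
    have h1 := hw (s.map (Function.Embedding.subtype _)) (by
      intro t ht
      simp only [Finset.mem_map, Function.Embedding.subtype_apply] at ht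
      obtain ⟨t, -, rfl⟩ := ht
      exact t.2)
    rw [Finset.card_map] at h1
    refine h1.trans_eq ?_
    have h2 : S.countP (fun x => ∃ t ∈ s.map (Function.Embedding.subtype _),
        t ∈ cornerTriples x) = ((Finset.univ : Finset S.ToType).val.map fun i => i.1).countP
          (fun x => ∃ t ∈ s.map (Function.Embedding.subtype _), t ∈ cornerTriples x) := by
      rw [Multiset.map_univ_coe]
    rw [h2, Multiset.countP_map]
    change (Finset.filter _ Finset.univ).card = _
    congr 1
    ext i
    simp [F]
  obtain ⟨f, hf, hfF⟩ := (Finset.all_card_le_biUnion_card_iff_exists_injective F).1 hF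
  refine ⟨fun t => if ht : t ∈ cornerTriples w then (f ⟨t, ht⟩).1 else 1, ?_, fun t ht => ?_⟩
  · have h1 : Multiset.map (fun t => if ht : t ∈ cornerTriples w then (f ⟨t, ht⟩).1 else 1)
        (cornerTriples w).val = ((Finset.univ.map ⟨f, hf⟩).val.map fun i => i.1) := by
      conv_lhs => rw [← Multiset.attach_map_val (cornerTriples w).val, Multiset.map_map]
      rw [Finset.map_val, Multiset.map_map, ← Finset.attach_eq_univ, Finset.attach_val]
      exact Multiset.map_congr rfl fun t _ => by
        have ht : t.1 ∈ cornerTriples w := t.2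
        simp only [Function.comp_apply, ht, dite_true, Function.Embedding.coeFn_mk]
        rfl
    rw [h1]
    conv_rhs => rw [← Multiset.map_univ_coe S]
    exact Multiset.map_le_map (Finset.val_le_iff.2 (Finset.subset_univ _))
  · have := hfF ⟨t, ht⟩
    simp only [F, Finset.mem_filter, Finset.mem_univ, true_and] at this
    simpa only [dif_pos ht] using this

theorem mem_cornerTriples_mul {σ x : CCube} {s : Finset Triple} :
    s ∈ cornerTriples x ↔ s.image (permTriple σ) ∈ cornerTriples (σ * x) := by
  have key : ∀ (σ x : CCube) (s : Finset Triple), s ∈ cornerTriples x →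
      s.image (permTriple σ) ∈ cornerTriples (σ * x) := by
    intro σ x s h
    obtain ⟨t, ht, rfl⟩ := mem_cornerTriples.1 h
    refine mem_cornerTriples.2 ⟨permTriple σ t, by rwa [cubeCorner_mul], ?_⟩
    simp [cycClass, Finset.image_insert, permTriple, cyc]
  refine ⟨key σ x s, fun h => ?_⟩
  have := key σ⁻¹ _ _ h
  rwa [inv_mul_cancel_left, Finset.image_image, show permTriple σ⁻¹ ∘ permTriple σ = id from
    funext (permTriple_inv_self σ), Finset.image_id] at this

theorem Blocked.map_mul {S : Multiset CCube} (h : Blocked S) (σ : CCube) :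
    Blocked (S.map (σ * ·)) := by
  intro w
  obtain ⟨T, hT, hlt⟩ := h (σ⁻¹ * w)
  have hinj : Function.Injective (Finset.image (permTriple σ)) :=
    Finset.image_injective (Function.LeftInverse.injective (permTriple_inv_self σ))
  refine ⟨T.image (Finset.image (permTriple σ)), ?_, ?_⟩
  · intro s hs
    obtain ⟨t, ht, rfl⟩ := Finset.mem_image.1 hs
    have := (mem_cornerTriples_mul (σ := σ)).1 (hT ht)
    rwa [mul_inv_cancel_left] at this
  · rw [Finset.card_image_of_injective _ hinj, Multiset.countP_map,
      ← Multiset.countP_eq_card_filter]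
    simpa only [Finset.exists_mem_image, ← mem_cornerTriples_mul] using hlt

theorem sum_countP_eq {α : Type*} (S : Multiset α) (f : α → ℕ) (E : Finset ℕ) :
    ∑ e ∈ E, S.countP (fun x => f x = e) = S.countP (fun x => f x ∈ E) := by
  induction S using Multiset.induction with
  | empty => simp
  | cons a S ih => simp [Multiset.countP_cons, Finset.sum_add_distrib, ih]

/-- The numbers of cubes of the various varieties in a blocked multiset of 24 cubes. -/
def IsBlockedCount (n : ℕ → ℕ) : Prop :=
  ∃ S : Multiset CCube, Multiset.card S = 24 ∧ Blocked S ∧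
    n = fun e => S.countP (fun x => arcIndex (arcOf x) = e)

theorem hallFamily_isBlockedCount : HallFamily IsBlockedCount where
  total := by
    rintro n ⟨S, hS, -, rfl⟩
    rw [sum_countP_eq, ← hS, Multiset.countP_eq_card]
    exact fun x _ => Finset.mem_range.2 (arcIndex_lt _)
  symm := by
    rintro n a b ha hb ⟨S, hS, hB, rfl⟩
    refine ⟨S.map (syn ⟨a, ha⟩ ⟨b, hb⟩ * ·), by rwa [Multiset.card_map], hB.map_mul _, ?_⟩
    ext e
    rw [Multiset.countP_map, ← Multiset.countP_eq_card_filter]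
    refine Multiset.countP_congr rfl fun x _ => ?_
    rw [arcOf_syn_mul, arcIndex_swapPair]
    refine propext ⟨fun h => ?_, fun h => ?_⟩
    · rw [h, swapArc_swapArc ha hb]
    · rw [← h, swapArc_swapArc ha hb]
  hall := by
    rintro n w ⟨S, hS, hB, rfl⟩ hw h7
    obtain ⟨p, rfl⟩ := exists_arcIndex_eq hw
    have hp : p.1 ≠ p.2 := fun h => h7 (by rw [arcIndex, h]; omega)
    obtain ⟨T, hT, hlt⟩ := hB (model p)
    choose! r hr hrT using fun s (hs : s ∈ T) => mem_cornerTriples.1 (hT hs)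
    refine ⟨T.image fun s => cornerMask (r s), ?_, ?_⟩
    · intro m hm
      obtain ⟨s, hs, rfl⟩ := Finset.mem_image.1 hm
      exact List.mem_toFinset.2 (cornerMask_mem hp (hr s hs))
    · rw [Finset.card_image_of_injOn]
      · refine lt_of_le_of_lt ?_ hlt
        rw [coverSum, sum_countP_eq, Multiset.countP_eq_card_filter,
          Multiset.countP_eq_card_filter]
        refine Multiset.card_le_card (Multiset.monotone_filter_right S fun x hx => ?_)
        obtain ⟨-, m, hm, hb⟩ := Finset.mem_filter.1 hx
        obtain ⟨s, hs, rfl⟩ := Finset.mem_image.1 hm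
        refine ⟨s, hs, ?_⟩
        rw [hrT s hs, cycClass_mem_cornerTriples, cubeCorner_arcOf]
        exact hb
      · intro s hs s' hs' h
        rw [hrT s hs, hrT s' hs']
        exact cycClass_eq_of_cornerMask_eq (hr s hs) h

theorem IsBlockedCount.eq_zero {n : ℕ → ℕ} (hn : IsBlockedCount n) {e : ℕ} (h7 : e % 7 = 0) :
    n e = 0 := by
  obtain ⟨S, -, -, rfl⟩ := hn
  rw [Multiset.countP_eq_zero]
  rintro x - rfl
  exact arcIndex_mod (arcOf_ne x) h7

/-! ### Conclusion -/

theorem startUpper_lt (N : ℕ) : startUpper N < 256 ^ 36 := by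
  rw [startUpper]
  exact pack_lt _

theorem within_startState {n : ℕ → ℕ} {M N : ℕ} (hM : M ≤ n 1) (hM' : M < 256) (hN : N < 256)
    (hn : ∀ e < 36, n e ≤ N) (h0 : ∀ e, e % 7 = 0 → n e = 0) :
    Within n (startState M N).1 (startState M N).2 := by
  unfold startState Within
  dsimp only
  refine ⟨?_, startUpper_lt N, fun e he => ⟨?_, ?_⟩⟩
  · change M * 256 < _
    calc M * 256 < 256 * 256 := by omega
      _ < _ := by norm_num
  · change M * 256 / 256 ^ e % 256 ≤ n e
    match e with
    | 0 => simp
    | 1 => simpa using (Nat.mod_le _ _).trans hM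
    | e + 2 =>
      rw [Nat.div_eq_of_lt]
      · simp
      · calc M * 256 < 256 * 256 := by omega
          _ ≤ 256 ^ e * (256 * 256) := Nat.le_mul_of_pos_left _ (by positivity)
          _ = _ := by ring
  · have h7 := h0 e
    rw [startUpper, byte_pack _ he, cond_beq]
    split_ifs with h
    · exact (h7 h).le
    · rw [Nat.mod_eq_of_lt hN]
      exact hn e he

theorem exists_swapArc_eq : ∀ e : Fin 36, e.val % 7 ≠ 0 → ∃ a b : Fin 6,
    swapArc 0 a (swapArc 1 b 1) = e := by
  decide +kernel

theorem IsBlockedCount.exists_le {n : ℕ → ℕ} (hn : IsBlockedCount n) :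
    ∃ n', IsBlockedCount n' ∧ ∀ e < 36, n' e ≤ n' 1 := by
  have hP := hallFamily_isBlockedCount
  obtain ⟨e, he, hmax⟩ := Finset.exists_max_image (Finset.range 36) n ⟨0, by simp⟩
  rw [Finset.mem_range] at he
  have hmax' : ∀ v < 36, n v ≤ n e := fun v hv => hmax v (Finset.mem_range.2 hv)
  have h7 : e % 7 ≠ 0 := by
    intro h7
    have h1 := hP.total hn
    rw [Finset.sum_eq_zero fun v hv => Nat.le_zero.1 ((hmax v hv).trans (hn.eq_zero h7).le)] at h1
    omega
  obtain ⟨a, b, hab⟩ := exists_swapArc_eq ⟨e, he⟩ h7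
  refine ⟨_, hP.symm (a := 1) (by norm_num) b.2 (hP.symm (a := 0) (by norm_num) a.2 hn),
    fun v hv => ?_⟩
  rw [hab]
  exact hmax' _ (swapArc_lt (by norm_num) a.2 (swapArc_lt (by norm_num) b.2 hv))

/-- Entry `M` refutes the existence of a blocked multiset in which the most frequent variety
occurs `M` times. -/
def refutations : List (List ℕ) :=
  [[1],
    [1],
    [157072490570, 157034741835, 10, 11, 16, 17, 22, 23, 24, 29, 9584718, 6, 16, 17, 20, 9584720,
      24, 8, 154628407393, 25, 1, 1, 73806, 15, 16, 17, 157034741841, 2, 9, 1, 84, 10, 11, 22,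
      23, 27, 29, 33, 1, 85, 18, 22, 23, 24, 26, 27, 29, 30, 32, 33, 1, 157034741850, 18, 16, 17,
      20, 157034741852, 1, 6, 157034741854, 1, 2, 1, 73808, 15, 16, 17, 18, 24, 30, 157034741841,
      1, 9, 24, 30, 31, 157034741851, 8, 19, 16, 17, 18, 157034741852, 1, 2, 157034741854, 1, 2,
      1, 157034815569, 9, 154618822738, 1, 10, 13, 23, 2, 9, 87, 2, 9, 15, 16, 17, 18,
      154618822744, 16, 23, 29, 30, 89, 17, 1, 90, 2, 9, 9, 16, 5, 8, 9, 2, 9, 157034741850, 18,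
      73819, 2, 19, 154618822750, 1, 22, 11, 13, 15, 17, 154618822752, 1, 18, 24, 18, 1,
      157034815579, 29, 34, 154618822750, 2, 19, 154618822753, 2, 19, 1, 1, 78, 157072490576, 15,
      16, 17, 157034741841, 1, 16, 17, 22, 23, 84, 19, 22, 23, 25, 26, 27, 29, 31, 32, 33, 1, 85,
      4, 5, 22, 23, 27, 29, 33, 1, 157034741851, 19, 16, 17, 20, 157034741852, 1, 6,
      157034741854, 1, 8, 1, 157072491156, 20, 26, 32, 157034741847, 15, 29, 34, 1, 157034741850,
      5, 25, 26, 27, 29, 157034741851, 12, 1, 157034741854, 1, 12, 1, 157072490583, 15, 29, 1,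
      154618822744, 1, 6, 1, 6, 1, 157072490576, 157034741841, 1, 9437268, 9, 12, 154618822744,
      1, 8, 12, 9, 12, 9437269, 24, 9, 154628259928, 1, 8, 154618822753, 8, 1, 8, 1, 8, 84, 85,
      3, 4, 5, 18, 22, 23, 24, 26, 27, 29, 30, 32, 33, 1, 157034741847, 8, 1, 12, 15, 3, 4, 5, 9,
      157034741850, 8, 18, 1, 8, 157034741851, 12, 1, 157034741852, 1, 8, 157034741854, 1, 8, 1,
      85, 18, 24, 30, 157034741851, 11, 24, 26, 27, 29, 157034741852, 1, 8, 157034741854, 1, 8,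
      1, 157034741847, 8, 1, 8, 15, 157034741850, 1, 8, 18, 157034741851, 8, 92, 1, 8,
      154618822750, 8, 19, 1, 19, 1, 157034741852, 1, 8, 1, 157072490580, 85, 20, 26, 32,
      157034741847, 10, 11, 18, 20, 157034741850, 18, 10, 11, 15, 157034741851, 12, 13,
      157034741854, 1, 12, 1, 157034741847, 1, 91, 12, 19, 1, 1, 12, 15, 157034741850, 1, 91, 12,
      1, 154618822750, 1, 12, 12, 18, 26, 27, 32, 33, 34, 157034741851, 12, 19, 1, 12,
      157072490581, 157034741847, 29, 34, 154618822744, 1, 18, 23, 25, 91, 15, 1, 92, 1, 13,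
      154618822750, 22, 2, 154618822753, 15, 25, 1, 157034741851, 10, 11, 27, 33, 1, 1, 13, 1],
    [157072490570, 157034741835, 10, 11, 16, 17, 22, 23, 24, 29, 78, 15, 16, 17, 20, 22, 23,
      9437264, 8, 16, 17, 19, 24, 26, 9437268, 12, 9, 10, 11, 22, 23, 9437269, 13, 10, 11, 15,
      16, 17, 18, 20, 9437271, 22, 23, 24, 27, 154618822753, 25, 16, 17, 22, 23, 154628259938,
      10, 1, 1, 78, 15, 16, 17, 22, 23, 27, 29, 33, 34, 157034741841, 2, 9, 22, 23, 26, 29, 32,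
      34, 1, 154618822754, 1, 2, 1, 2, 84, 9, 10, 11, 22, 23, 27, 29, 33, 34, 1, 2, 85, 18, 20,
      22, 23, 24, 26, 27, 29, 30, 32, 33, 34, 157034741799, 13, 1, 1, 157034741850, 18, 16, 17,
      26, 27, 29, 157034741852, 29, 1, 1, 2, 80, 15, 16, 17, 18, 22, 23, 24, 27, 29, 30, 33, 34,
      157034741841, 1, 9, 84, 9, 10, 11, 19, 22, 23, 25, 27, 29, 31, 33, 34, 1, 2, 157034741851,
      19, 16, 17, 22, 23, 24, 29, 32, 1, 157034741852, 1, 2, 1, 2, 157034741841, 9, 22, 23, 24,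
      29, 30, 34, 154618822738, 1, 9, 10, 3, 87, 1, 15, 154618822744, 1, 16, 18, 27, 29, 30, 89,
      1, 16, 91, 16, 1, 98, 1, 9, 103, 9, 1, 1, 16, 90, 2, 9, 154618822753, 9, 18, 1, 91, 26, 29,
      34, 1, 154618822753, 9, 25, 1, 154618822754, 1, 9, 1, 2, 84, 9, 10, 11, 22, 23, 27, 29, 33,
      34, 157034741847, 1, 2, 157034741850, 1, 12, 157034741851, 12, 29, 34, 1, 1, 2, 85, 18, 22,
      23, 24, 27, 29, 30, 33, 34, 157034741847, 2, 24, 26, 30, 1, 157034741851, 10, 11, 24, 26,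
      27, 30, 157034741852, 10, 1, 1, 2, 157034741847, 15, 22, 23, 24, 29, 30, 34, 154618822744,
      1, 15, 90, 1, 15, 92, 1, 2, 154618822753, 15, 25, 1, 154618822754, 1, 15, 1, 2,
      157034741850, 18, 91, 2, 27, 33, 1, 92, 1, 2, 154618822750, 1, 18, 154618822752, 1, 18,
      154618822753, 18, 25, 1, 154618822754, 18, 1, 1, 2, 157034741851, 27, 29, 33, 34,
      154618822750, 2, 15, 24, 26, 27, 154618822753, 15, 1, 1, 19, 157034741852, 27, 33, 1, 2, 1,
      2, 78, 157072490576, 15, 16, 17, 22, 23, 27, 29, 33, 34, 157034741841, 1, 9, 4, 5, 15, 84,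
      19, 20, 22, 23, 25, 26, 27, 29, 31, 32, 33, 34, 1, 8, 85, 3, 4, 5, 22, 23, 27, 29, 33, 34,
      1, 8, 157034741851, 19, 16, 17, 26, 27, 29, 1, 157034741852, 1, 6, 1, 8, 157072490580, 20,
      22, 23, 26, 27, 29, 32, 33, 34, 157034741847, 1, 6, 157034741850, 1, 12, 157034741851, 27,
      33, 12, 19, 1, 12, 157072490581, 20, 22, 23, 26, 27, 29, 32, 33, 34, 157034741847, 29, 34,
      1, 157034741851, 10, 26, 27, 32, 33, 1, 13, 157072490583, 15, 29, 1, 154618822744, 1, 6, 1,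
      154618822750, 1, 22, 1, 6, 1, 157072490576, 157034741841, 1, 8, 9, 29, 30, 84, 85, 3, 4, 5,
      18, 20, 22, 23, 24, 26, 27, 29, 30, 32, 33, 34, 1, 8, 157034741847, 1, 8, 157034741850, 1,
      8, 157034741851, 12, 26, 27, 29, 32, 33, 34, 154618822750, 8, 1, 19, 1, 157034741852, 1, 8,
      157034741854, 1, 8, 12, 1, 85, 18, 22, 23, 24, 27, 29, 30, 33, 34, 157034741851, 10, 11,
      24, 26, 27, 30, 32, 1, 13, 1, 20, 26, 32, 1207959644, 1, 1, 157034741847, 1, 8,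
      157034741850, 1, 8, 157034741851, 8, 27, 33, 92, 1, 8, 1, 154618822750, 8, 1, 1,
      154618822754, 1, 8, 1, 8, 1, 157034741852, 1, 8, 1, 8, 157072490580, 85, 20, 22, 23, 26,
      27, 29, 32, 33, 34, 157034741847, 1, 12, 157034741850, 1, 12, 157034741851, 10, 11, 26, 27,
      30, 1, 12, 157034741847, 1, 12, 157034741850, 1, 12, 157034741851, 12, 26, 29, 32, 34,
      154618822750, 12, 1, 1, 154618822755, 1, 12, 12, 1, 12, 1, 12, 157072490581, 157034741847,
      22, 23, 26, 29, 32, 34, 154618822744, 1, 15, 91, 10, 11, 26, 27, 32, 92, 1, 13,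
      154618822753, 9, 11, 18, 22, 30, 32, 1, 13, 157034741851, 10, 11, 26, 27, 32, 33, 1, 13,
      19, 157034741852, 1, 20, 16, 17, 22, 1, 13, 1, 157072490583, 1, 15, 1],
    [157072490570, 9, 10, 11, 15, 16, 17, 18, 22, 23, 24, 27, 29, 30, 33, 34, 157034741835, 6, 8,
      10, 11, 12, 13, 16, 17, 19, 20, 22, 23, 24, 25, 26, 29, 31, 32, 78, 6, 16, 17, 22, 23, 24,
      9437264, 1, 16, 17, 19, 24, 26, 32, 9437268, 10, 11, 22, 23, 24, 9437269, 13, 10, 11, 24,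
      25, 29, 31, 9437271, 1, 22, 23, 24, 27, 33, 154618822753, 16, 1, 1, 10, 1, 78, 15, 16, 17,
      20, 22, 23, 26, 27, 29, 32, 33, 34, 84, 1, 9, 22, 23, 27, 29, 33, 34, 157034741799, 10, 1,
      1, 85, 9, 10, 11, 18, 20, 22, 23, 24, 26, 27, 29, 30, 32, 33, 34, 157034741799, 10, 1, 1,
      157034741841, 2, 26, 29, 34, 1, 2, 157034741850, 1, 16, 17, 27, 33, 6, 1, 80, 1, 18, 19,
      22, 23, 25, 27, 29, 31, 33, 34, 84, 19, 22, 23, 25, 27, 29, 31, 33, 34, 157034741799, 10,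
      1, 1, 8, 2, 157034741851, 8, 1, 1, 84, 1, 9, 19, 22, 23, 25, 27, 29, 31, 33, 34, 12,
      157034741851, 2, 12, 1, 1, 85, 9, 10, 11, 18, 20, 22, 23, 24, 26, 27, 29, 30, 32, 33, 34,
      157034741851, 2, 10, 11, 24, 26, 27, 30, 32, 1, 157034741847, 1, 15, 13, 1, 157034741851,
      10, 11, 15, 16, 17, 24, 26, 27, 29, 30, 32, 33, 34, 154618822753, 2, 15, 33, 1, 81, 2, 29,
      1, 90, 27, 1, 154618822750, 1, 22, 154618822754, 1, 26, 154618822738, 10, 1, 1, 2, 1,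
      157034741852, 1, 20, 1, 2, 157034741841, 1, 2, 1, 78, 15, 16, 17, 20, 22, 23, 26, 27, 29,
      32, 33, 34, 157072490576, 1, 19, 22, 23, 25, 27, 29, 31, 33, 34, 84, 3, 19, 22, 23, 25, 27,
      29, 31, 33, 34, 38, 15, 1, 157034741799, 3, 1, 1, 85, 22, 23, 27, 29, 33, 34, 38, 15, 1,
      157034741799, 3, 1, 1, 8, 157034741851, 19, 16, 17, 27, 29, 1, 157072490580, 1, 19, 20, 22,
      23, 25, 27, 29, 31, 33, 34, 12, 157034741851, 12, 1, 6, 1, 157072490581, 20, 22, 23, 26,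
      27, 29, 32, 33, 34, 6, 157034741851, 6, 26, 27, 32, 33, 34, 1, 1, 157072490576, 1, 84, 19,
      22, 23, 25, 27, 29, 31, 33, 34, 85, 3, 4, 5, 22, 23, 27, 29, 33, 34, 38, 9, 1,
      157034741799, 3, 1, 1, 157034741851, 8, 12, 29, 1, 8, 1, 8, 12, 85, 22, 23, 27, 29, 33, 34,
      8, 157034741851, 24, 27, 30, 33, 34, 1, 8, 157034741851, 8, 29, 1, 8, 1, 157072490580, 1,
      85, 22, 23, 27, 29, 33, 34, 12, 157034741851, 10, 11, 26, 32, 33, 1, 12, 157034741851, 12,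
      27, 1, 12, 1, 157072490581, 20, 22, 23, 26, 27, 29, 32, 33, 34, 157034741847, 1, 22, 23,
      26, 32, 91, 10, 11, 26, 32, 33, 154618822753, 18, 1, 1, 157034741851, 10, 11, 26, 27, 32,
      33, 1, 13, 19, 3, 1, 1],
    [157072490570, 9, 10, 11, 15, 16, 17, 18, 22, 23, 24, 27, 29, 30, 33, 34, 157034741835, 6, 8,
      10, 11, 12, 13, 16, 17, 19, 20, 22, 23, 24, 25, 26, 29, 31, 32, 78, 15, 16, 17, 20, 22, 23,
      24, 29, 9437264, 1, 3, 8, 9437268, 1, 3, 12, 9437269, 13, 10, 11, 24, 29, 2, 9437271, 1,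
      15, 154618822753, 16, 17, 1, 154628259938, 1, 2, 154618822696, 11, 1, 1, 78, 15, 16, 17,
      20, 22, 23, 26, 27, 29, 32, 33, 34, 84, 1, 9, 6, 85, 9, 10, 11, 18, 20, 22, 23, 24, 26, 27,
      29, 30, 32, 33, 34, 157034741799, 6, 13, 11, 16, 17, 20, 22, 44, 18, 1, 157034741805, 9, 1,
      48, 9, 1, 2, 6, 157034741841, 1, 2, 157034741850, 1, 2, 157034741852, 1, 2, 157034741854,
      1, 2, 157034741799, 6, 1, 1, 80, 1, 18, 19, 25, 31, 8, 84, 1, 12, 9, 19, 25, 27, 31, 85, 9,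
      10, 11, 18, 20, 22, 23, 24, 26, 27, 29, 30, 32, 33, 34, 157034741851, 2, 10, 11, 16, 17,
      26, 32, 1, 157034741847, 1, 2, 157034741852, 1, 2, 157034741854, 1, 2, 157034741799, 13, 1,
      1, 157034741851, 10, 11, 15, 16, 17, 24, 26, 27, 29, 30, 32, 33, 34, 154618822753, 2, 11,
      15, 33, 1, 81, 1, 2, 90, 1, 2, 154618822750, 1, 2, 19, 1, 19, 1, 2, 9, 10, 11, 78, 15, 16,
      17, 20, 22, 23, 26, 27, 29, 32, 33, 34, 157072490576, 1, 19, 25, 31, 84, 3, 8, 8,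
      157072490580, 1, 6, 12, 157072490581, 20, 22, 23, 26, 27, 29, 32, 33, 34, 157034741851, 6,
      26, 32, 1, 157034741847, 1, 6, 157034741854, 1, 6, 38, 157034741799, 6, 1, 1, 1, 1,
      157072490576, 1, 12, 8, 157072490580, 1, 12, 157072490581, 20, 22, 23, 26, 27, 29, 32, 33,
      34, 157034741847, 1, 15, 157034741851, 10, 11, 26, 27, 32, 33, 92, 1, 13, 154618822750, 1,
      13, 9437222, 10, 1, 1, 1, 1],
    [1, 6, 157072490570, 13, 19, 25, 31, 157034741835, 6, 10, 11, 13, 19, 25, 31, 78, 2, 15, 16,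
      17, 20, 1, 9437269, 2, 10, 11, 24, 29, 3, 154618822753, 2, 3, 16, 1, 154618822696, 17, 1,
      42, 16, 1, 1, 2, 78, 15, 16, 17, 85, 157034741799, 6, 13, 10, 16, 17, 20, 22, 23, 44, 1, 2,
      157034741805, 1, 2, 48, 1, 2, 157034741811, 1, 2, 157034741814, 1, 2, 6, 157034741799, 6,
      1, 1, 85, 157034741851, 2, 10, 11, 1, 157034741799, 13, 1, 1, 157034741851, 154618822753,
      2, 15, 1, 39, 19, 1, 1, 1, 157072490581, 157034741851, 6, 10, 11, 78, 13, 26, 32, 1,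
      9437222, 10, 11, 1, 154618822696, 26, 1, 1, 13, 78, 38, 157034741799, 6, 1, 1, 1, 1, 1],
    [1, 6, 157072490570, 13, 19, 25, 31, 157034741835, 6, 10, 11, 13, 19, 25, 31, 2, 3, 78, 6,
      15, 16, 20, 2, 3, 2, 6, 2, 85, 157034741851, 2, 15, 2, 2, 6, 157072490581, 157034741851,
      10, 11, 13, 19, 13]]

theorem refute_refutations : ∀ M : Fin 8,
    refute (refutations.getD M []) [startState M M] = true := by
  decide +kernel

theorem refute_of_eight_le : refute [1] [startState 8 24] = true := by decide +kernel

theorem not_isBlockedCount (n : ℕ → ℕ) : ¬ IsBlockedCount n := by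
  intro hn
  obtain ⟨n, hn, hmax⟩ := hn.exists_le
  have hP := hallFamily_isBlockedCount
  have key : ∀ {ds M N}, refute ds [startState M N] = true → M ≤ n 1 → n 1 ≤ N → M < 256 →
      N < 256 → False := fun h hM hN hM' hN' =>
    not_within_of_refute hP h (List.mem_singleton_self _) hn
      (within_startState hM hM' hN' (fun e he => (hmax e he).trans hN) fun e he => hn.eq_zero he)
  have h24 : n 1 ≤ 24 := by
    rw [← hP.total hn]
    exact Finset.single_le_sum (fun _ _ => Nat.zero_le _) (Finset.mem_range.2 (by norm_num))
  rcases Nat.lt_or_ge (n 1) 8 with h | h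
  · exact key (refute_refutations ⟨n 1, h⟩) le_rfl le_rfl (by omega) (by omega)
  · exact key refute_of_eight_le h h24 (by norm_num) (by norm_num)

/-- Every multiset of 24 colored cubes contains a corner solution. -/
theorem twentyfour_corner_solution (S : Multiset CCube) (h : Multiset.card S = 24) :
    HasCornerSolution S := by
  by_contra hS
  exact not_isBlockedCount _ ⟨S, h, blocked_of_not_hasCornerSolution hS, rfl⟩
end
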